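/- Let f : ℝ² → ℝ be a real polynomial of degree d ≥ 1 with f(0) = 0. Then the classical Łojasiewicz exponent of f at the origin satisfies 𝓛̃(f) ≤ 1/(1 - ℒ(f)), and consequently 𝓛̃(f) ≤ (d-1)² + 1. -/

import Mathlib

noncomputable def LGE {𝕜 : Type*} [RCLike 𝕜] {E : Type*} [NormedAddCommGroup E]
    [NormedSpace 𝕜 E] (f : E → 𝕜) : ℝ :=
  sInf {l : ℝ | 0 < l ∧ ∃ c > (0:ℝ), ∃ ε > (0:ℝ), ∀ z : E, ‖z‖ < ε →
    c * ‖f z‖ ^ l ≤ ‖fderiv 𝕜 f z‖}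

/-- The classical Łojasiewicz exponent at the origin: the infimum of exponents `l > 0`
such that `|f z| ≥ c · dist(z, f⁻¹(0))^l` holds near `0` for some `c > 0`. -/
noncomputable def LDE (f : EuclideanSpace ℝ (Fin 2) → ℝ) : ℝ :=
  sInf {l : ℝ | 0 < l ∧ ∃ c > (0:ℝ), ∃ ε > (0:ℝ), ∀ z : EuclideanSpace ℝ (Fin 2),
    ‖z‖ < ε → c * (Metric.infDist z {w | f w = 0}) ^ l ≤ |f z|}

section

open Polynomial
open scoped Polynomial.Bivariate
open Filter Topology Set

/-- The polynomial `a` has degree at most the integer `k`; for `k < 0` this means `a = 0`. -/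
def DegLE (a : ℝ[X]) (k : ℤ) : Prop := ∀ m : ℕ, k < m → a.coeff m = 0

/-- The bivariate polynomial `q` has total degree at most `n`. -/
def TotalDegLE (q : ℝ[X][Y]) (n : ℤ) : Prop := ∀ i : ℕ, DegLE (q.coeff i) (n - i)

lemma DegLE.mono {a : ℝ[X]} {k l : ℤ} (h : DegLE a k) (hkl : k ≤ l) : DegLE a l :=
  fun m hm => h m (by omega)

lemma DegLE.mul {a b : ℝ[X]} {k l : ℤ} (ha : DegLE a k) (hb : DegLE b l) :
    DegLE (a * b) (k + l) := by
  intro m hm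
  rw [coeff_mul]
  refine Finset.sum_eq_zero fun x hx => ?_
  have hx' := Finset.HasAntidiagonal.mem_antidiagonal.1 hx
  by_cases h : k < x.1
  · rw [ha _ h, zero_mul]
  · rw [hb _ (by omega), mul_zero]

lemma DegLE.sum {ι : Type*} {s : Finset ι} {a : ι → ℝ[X]} {k : ℤ}
    (h : ∀ i ∈ s, DegLE (a i) k) : DegLE (∑ i ∈ s, a i) k := by
  intro m hm
  rw [finsetSum_coeff]
  exact Finset.sum_eq_zero fun i hi => h i hi m hm

lemma DegLE.prod {ι : Type*} {s : Finset ι} {a : ι → ℝ[X]} {k : ι → ℤ}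
    (h : ∀ i ∈ s, DegLE (a i) (k i)) : DegLE (∏ i ∈ s, a i) (∑ i ∈ s, k i) := by
  classical
  induction s using Finset.induction_on with
  | empty =>
    intro m hm
    simp only [Finset.prod_empty, coeff_one, Finset.sum_empty] at hm ⊢
    rw [if_neg (by omega)]
  | insert i s hi ih =>
    rw [Finset.prod_insert hi, Finset.sum_insert hi]
    exact (h i (by simp)).mul (ih fun j hj => h j (by simp [hj]))

lemma DegLE.derivative {a : ℝ[X]} {k : ℤ} (h : DegLE a k) : DegLE (derivative a) (k - 1) := by
  intro m hm
  rw [coeff_derivative, h (m + 1) (by push_cast; omega), zero_mul]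

lemma DegLE.natDegree_le {a : ℝ[X]} {k : ℕ} (h : DegLE a k) : a.natDegree ≤ k :=
  natDegree_le_iff_coeff_eq_zero.2 fun m hm => h m (by exact_mod_cast hm)

lemma TotalDegLE.mono {q : ℝ[X][Y]} {n m : ℤ} (h : TotalDegLE q n) (hnm : n ≤ m) :
    TotalDegLE q m := fun i => (h i).mono (by omega)

lemma TotalDegLE.mul {p q : ℝ[X][Y]} {n m : ℤ} (hp : TotalDegLE p n) (hq : TotalDegLE q m) :
    TotalDegLE (p * q) (n + m) := by
  intro i
  rw [coeff_mul]
  refine DegLE.sum fun x hx => ?_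
  have hx' := Finset.HasAntidiagonal.mem_antidiagonal.1 hx
  exact ((hp x.1).mul (hq x.2)).mono (by omega)

lemma TotalDegLE.add {p q : ℝ[X][Y]} {n : ℤ} (hp : TotalDegLE p n) (hq : TotalDegLE q n) :
    TotalDegLE (p + q) n := by
  intro i m hm
  rw [coeff_add, coeff_add, hp i m hm, hq i m hm, add_zero]

lemma TotalDegLE.sub {p q : ℝ[X][Y]} {n : ℤ} (hp : TotalDegLE p n) (hq : TotalDegLE q n) :
    TotalDegLE (p - q) n := by
  intro i m hm
  rw [coeff_sub, coeff_sub, hp i m hm, hq i m hm, sub_zero]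

lemma TotalDegLE.sum {ι : Type*} {s : Finset ι} {a : ι → ℝ[X][Y]} {k : ℤ}
    (h : ∀ i ∈ s, TotalDegLE (a i) k) : TotalDegLE (∑ i ∈ s, a i) k := by
  intro j
  rw [finsetSum_coeff]
  exact DegLE.sum fun i hi => h i hi j

lemma TotalDegLE.const {a : ℝ[X]} {k : ℤ} (h : DegLE a k) : TotalDegLE (C a) k := by
  intro i m hm
  rw [coeff_C]
  split_ifs with hi
  · exact h m (by omega)
  · simp

lemma TotalDegLE.real (c : ℝ) : TotalDegLE (C (C c)) 0 :=
  .const fun m hm => by rw [coeff_C, if_neg (by omega)]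

lemma TotalDegLE.X_pow (j : ℕ) : TotalDegLE (X ^ j : ℝ[X][Y]) j := by
  intro i m hm
  rw [coeff_X_pow]
  split_ifs with hi
  · rw [coeff_one, if_neg (by omega)]
  · simp

lemma TotalDegLE.derivative {q : ℝ[X][Y]} {n : ℤ} (h : TotalDegLE q n) :
    TotalDegLE (derivative q) (n - 1) := by
  intro i m hm
  have := h (i + 1) m (by push_cast; omega)
  rw [coeff_derivative]
  have e : ((i : ℝ[X]) + 1) = C ((i : ℝ) + 1) := by simp
  rw [e, coeff_mul_C, this, zero_mul]

lemma TotalDegLE.modByMonic {p : ℝ[X][Y]} (hp : p.Monic) (hpD : TotalDegLE p p.natDegree)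
    {q : ℝ[X][Y]} {n : ℤ} (hq : TotalDegLE q n) : TotalDegLE (q %ₘ p) n := by
  induction h : q.natDegree using Nat.strong_induction_on generalizing q with
  | _ N ih =>
    subst h
    by_cases hlt : q.degree < p.degree
    · rwa [(modByMonic_eq_self_iff hp).2 hlt]
    · rw [not_lt] at hlt
      have hq0 : q ≠ 0 := by
        rintro rfl
        rw [degree_zero, le_bot_iff, degree_eq_bot] at hlt
        exact hp.ne_zero hlt
      have hle : p.natDegree ≤ q.natDegree := natDegree_le_natDegree hlt
      set q' := q - p * (C q.leadingCoeff * X ^ (q.natDegree - p.natDegree)) with hq'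
      have hdeg : q'.degree < q.degree := div_wf_lemma ⟨hlt, hq0⟩ hp
      have hq'D : TotalDegLE q' n := by
        refine hq.sub ((hpD.mul ((TotalDegLE.const (hq q.natDegree)).mul (.X_pow _))).mono ?_)
        push_cast [hle]
        omega
      have hmod : q %ₘ p = q' %ₘ p := by
        refine modByMonic_eq_of_dvd_sub hp ?_
        rw [hq', sub_sub_cancel]
        exact dvd_mul_right _ _
      rw [hmod]
      by_cases h0 : q' = 0
      · rw [h0, zero_modByMonic]
        intro i m _
        simp
      · exact ih _ (natDegree_lt_natDegree h0 hdeg) hq'D rfl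

lemma exists_top_form {v : ℝ[X][Y]} (hv : v.Monic) : ∃ a i k : ℕ, a = i + k ∧ v.natDegree ≤ a ∧
    (v.coeff i).coeff k ≠ 0 ∧ TotalDegLE v a ∧ ∀ j, i < j → DegLE (v.coeff j) (a - j - 1) := by
  classical
  set S : Finset (ℕ × ℕ) := v.support.sigma (fun i => (v.coeff i).support) |>.image
    (fun s => (s.1, s.2)) with hS
  have hmem : ∀ i k, (i, k) ∈ S ↔ (v.coeff i).coeff k ≠ 0 := by
    intro i k
    simp only [hS, Finset.mem_image, Finset.mem_sigma, mem_support_iff, Sigma.exists, Prod.mk.injEq]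
    constructor
    · rintro ⟨a, b, ⟨_, h⟩, rfl, rfl⟩
      exact h
    · intro h
      exact ⟨i, k, ⟨fun h0 => h (by simp [h0]), h⟩, rfl, rfl⟩
  have htop : (v.natDegree, 0) ∈ S := by
    rw [hmem, hv.coeff_natDegree]
    simp
  obtain ⟨s, hs, hsmax⟩ := S.exists_max_image (fun s => s.1 + s.2) ⟨_, htop⟩
  set T := S.filter (fun r => r.1 + r.2 = s.1 + s.2) with hT
  obtain ⟨r, hr, hrmax⟩ := T.exists_max_image (fun r => r.1) ⟨s, by simp [hT, hs]⟩
  rw [hT, Finset.mem_filter] at hr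
  refine ⟨r.1 + r.2, r.1, r.2, rfl, ?_, (hmem _ _).1 hr.1, ?_, ?_⟩
  · rw [hr.2]
    simpa using hsmax _ htop
  · intro i m hm
    by_contra h
    have := hsmax _ ((hmem i m).2 h)
    simp only at this
    omega
  · intro j hj m hm
    by_contra h
    have hjm := (hmem j m).2 h
    have h1 := hsmax _ hjm
    simp only at h1
    have := hrmax (j, m) (by rw [hT, Finset.mem_filter]; exact ⟨hjm, by simp only; omega⟩)
    simp only at this
    omega

lemma TotalDegLE.of_mul {v u : ℝ[X][Y]} (hv : v.Monic) (hu : u.Monic)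
    (h : TotalDegLE (v * u) (v * u).natDegree) : TotalDegLE v v.natDegree := by
  obtain ⟨a, i, k, ha, hva, hik, hvD, hvt⟩ := exists_top_form hv
  obtain ⟨b, j, l, hb, hub, hjl, huD, hut⟩ := exists_top_form hu
  have hne : ((v * u).coeff (i + j)).coeff (k + l) ≠ 0 := by
    rw [coeff_mul, finsetSum_coeff, Finset.sum_eq_single (i, j)]
    · rw [coeff_mul, Finset.sum_eq_single (k, l)]
      · exact mul_ne_zero hik hjl
      · rintro ⟨m, n⟩ hmn hne
        rw [Finset.HasAntidiagonal.mem_antidiagonal] at hmn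
        simp only at hmn
        by_cases hm : k < m
        · rw [hvD i m (by omega), zero_mul]
        · have : l < n := by
            by_contra hn
            exact hne (by ext <;> simp only <;> omega)
          rw [huD j n (by omega), mul_zero]
      · intro h
        simp at h
    · rintro ⟨m, n⟩ hmn hne
      rw [Finset.HasAntidiagonal.mem_antidiagonal] at hmn
      simp only at hmn
      by_cases hm : i < m
      · exact ((hvt m hm).mul (huD n)) _ (by omega)
      · have hn : j < n := by
          by_contra hn
          exact hne (by ext <;> simp only <;> omega)
        exact ((hvD m).mul (hut n hn)) _ (by omega)
    · intro h
      simp at h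
  have hle : i + j + (k + l) ≤ (v * u).natDegree := by
    by_contra hlt
    exact hne (h (i + j) (k + l) (by omega))
  rw [hv.natDegree_mul hu] at hle
  have : a = v.natDegree := by omega
  rwa [this] at hvD

/-- Elimination of `y` between a monic prime polynomial and a polynomial it does not divide. -/
lemma exists_eliminant {p q : ℝ[X][Y]} (hp : p.Monic) (hpD : TotalDegLE p p.natDegree)
    (hpr : Prime p) {n : ℕ} (hq : TotalDegLE q n) (hpq : ¬ p ∣ q) :
    ∃ (R : ℝ[X]) (a u : ℝ[X][Y]), R ≠ 0 ∧ R.natDegree ≤ p.natDegree * n ∧ q * a = p * u + C R := by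
  classical
  set e := p.natDegree with he
  have he0 : 0 < e := by
    rw [he, Nat.pos_iff_ne_zero]
    intro h0
    exact hpr.not_isUnit (by rw [hp.natDegree_eq_zero.1 h0]; exact isUnit_one)
  set M : Matrix (Fin e) (Fin e) ℝ[X] := Matrix.of fun i j => ((q * X ^ (j : ℕ)) %ₘ p).coeff i
    with hM
  have hmod : ∀ c : Fin e → ℝ[X], ∀ i : Fin e,
      ((q * ∑ j, C (c j) * X ^ (j : ℕ)) %ₘ p).coeff i = (M.mulVec c) i := by
    intro c i
    have : (q * ∑ j, C (c j) * X ^ (j : ℕ)) %ₘ p =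
        ∑ j, c j • ((q * X ^ (j : ℕ)) %ₘ p) := by
      simp_rw [← smul_modByMonic, ← modByMonicHom_apply, ← map_sum]
      congr 1
      rw [Finset.mul_sum]
      refine Finset.sum_congr rfl fun j _ => ?_
      rw [smul_eq_C_mul]
      ring
    rw [this, finsetSum_coeff, Matrix.mulVec, dotProduct]
    refine Finset.sum_congr rfl fun j _ => ?_
    simp [hM, mul_comm]
  have hmod_lt : ∀ (g : ℝ[X][Y]) (i : ℕ), e ≤ i → (g %ₘ p).coeff i = 0 := by
    intro g i hi
    refine coeff_eq_zero_of_degree_lt ((degree_modByMonic_lt g hp).trans_le ?_)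
    rw [degree_eq_natDegree hp.ne_zero]
    exact_mod_cast hi
  have hdet : M.det ≠ 0 := by
    intro h0
    obtain ⟨c, hc, hMc⟩ := Matrix.exists_mulVec_eq_zero_iff.2 h0
    have hz : (q * ∑ j, C (c j) * X ^ (j : ℕ)) %ₘ p = 0 := by
      ext1 i
      by_cases hi : i < e
      · rw [hmod c ⟨i, hi⟩, hMc]; rfl
      · rw [hmod_lt _ _ (not_lt.1 hi)]; rfl
    rw [modByMonic_eq_zero_iff_dvd hp] at hz
    rcases hpr.dvd_or_dvd hz with h | h
    · exact hpq h
    · have hlt : (∑ j : Fin e, C (c j) * X ^ (j : ℕ)).degree < p.degree := by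
        rw [degree_eq_natDegree hp.ne_zero]
        exact degree_sum_fin_lt c
      have hs0 := eq_zero_of_dvd_of_degree_lt h hlt
      apply hc
      ext1 i
      have := congrArg (fun g => g.coeff (i : ℕ)) hs0
      simp only [finsetSum_coeff, coeff_C_mul_X_pow, coeff_zero] at this
      rw [Finset.sum_eq_single i] at this
      · simpa using this
      · intro j _ hj
        rw [if_neg]
        exact fun h => hj (Fin.ext h.symm)
      · simp
  set z : Fin e := ⟨0, he0⟩
  set c : Fin e → ℝ[X] := fun j => M.adjugate j z with hc
  set a : ℝ[X][Y] := ∑ j, C (c j) * X ^ (j : ℕ) with ha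
  have hMc : ∀ i, (M.mulVec c) i = if i = z then M.det else 0 := by
    intro i
    have := congrFun (congrFun (Matrix.mul_adjugate M) i) z
    rw [Matrix.smul_apply, Matrix.one_apply, Matrix.mul_apply] at this
    simpa [Matrix.mulVec, dotProduct, hc] using this
  have hqa : (q * a) %ₘ p = C M.det := by
    ext1 i
    by_cases hi : i < e
    · rw [hmod c ⟨i, hi⟩, hMc, coeff_C]
      simp [z]
    · rw [hmod_lt _ _ (not_lt.1 hi), coeff_C, if_neg (by omega)]
  refine ⟨M.det, a, (q * a) /ₘ p, hdet, ?_, ?_⟩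
  · refine DegLE.natDegree_le ?_
    rw [Matrix.det_apply]
    refine DegLE.sum fun σ _ => ?_
    have h1 : DegLE (∏ i, M (σ i) i) (∑ i : Fin e, ((n : ℤ) + i - (σ i : ℕ))) := by
      refine DegLE.prod fun i _ => ?_
      exact (TotalDegLE.modByMonic hp hpD (hq.mul (.X_pow (i : ℕ)))) _
    have h2 : (∑ i : Fin e, ((n : ℤ) + i - (σ i : ℕ))) = ((e * n : ℕ) : ℤ) := by
      rw [Finset.sum_sub_distrib, Finset.sum_add_distrib,
        Equiv.sum_comp σ (fun i : Fin e => ((i : ℕ) : ℤ))]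
      simp
    rw [h2] at h1
    intro m hm
    rw [Units.smul_def, coeff_smul, h1 m hm, smul_zero]
  · rw [← hqa, add_comm]
    exact (modByMonic_add_div (q * a) p).symm

lemma exists_relation_mod {p : ℝ[X][Y]} (hp : p.Monic) (g : Fin (p.natDegree + 1) → ℝ[X][Y]) :
    ∃ a : Fin (p.natDegree + 1) → ℝ[X], a ≠ 0 ∧ p ∣ ∑ k, C (a k) * g k := by
  set w : Fin (p.natDegree + 1) → (Fin p.natDegree → ℝ[X]) := fun k i => (g k %ₘ p).coeff i
  have hw : ¬ LinearIndependent ℝ[X] w := by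
    intro h
    have := h.fintype_card_le_finrank
    simp at this
  obtain ⟨a, ha, i, hi⟩ := Fintype.not_linearIndependent_iff.1 hw
  refine ⟨a, fun h => hi (by rw [h]; rfl), ?_⟩
  rw [← modByMonic_eq_zero_iff_dvd hp]
  have hsum : (∑ k, C (a k) * g k) %ₘ p = ∑ k, a k • (g k %ₘ p) := by
    simp_rw [← smul_eq_C_mul, ← smul_modByMonic, ← modByMonicHom_apply, ← map_sum]
  ext1 j
  by_cases hj : j < p.natDegree
  · have := congrFun ha ⟨j, hj⟩
    rw [hsum, finsetSum_coeff]
    simpa [w] using this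
  · rw [coeff_zero]
    refine coeff_eq_zero_of_degree_lt ((degree_modByMonic_lt _ hp).trans_le ?_)
    rw [degree_eq_natDegree hp.ne_zero]
    exact_mod_cast not_lt.1 hj

/-- The partial derivative with respect to the inner variable `X`. -/
noncomputable def derivX (q : ℝ[X][Y]) : ℝ[X][Y] := q.sum fun i a => C (derivative a) * X ^ i

lemma coeff_derivX (q : ℝ[X][Y]) (i : ℕ) : (derivX q).coeff i = derivative (q.coeff i) := by
  rw [derivX, Polynomial.sum, finsetSum_coeff]
  simp only [coeff_C_mul_X_pow]
  rw [Finset.sum_ite_eq]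
  split_ifs with h
  · rfl
  · rw [notMem_support_iff.1 h, derivative_zero]

lemma derivX_add (p q : ℝ[X][Y]) : derivX (p + q) = derivX p + derivX q := by
  ext1 i
  simp [coeff_derivX]

lemma derivX_monomial (n : ℕ) (a : ℝ[X]) : derivX (monomial n a) = monomial n (derivative a) := by
  ext1 i
  simp only [coeff_derivX, coeff_monomial]
  split_ifs <;> simp

lemma TotalDegLE.derivX {q : ℝ[X][Y]} {n : ℤ} (h : TotalDegLE q n) :
    TotalDegLE (derivX q) (n - 1) := by
  intro i
  rw [coeff_derivX]
  exact (h i).derivative.mono (by omega)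

lemma hasStrictFDerivAt_evalEval (q : ℝ[X][Y]) (z : ℝ × ℝ) :
    HasStrictFDerivAt (fun w : ℝ × ℝ => evalEval w.1 w.2 q)
      (evalEval z.1 z.2 (derivX q) • ContinuousLinearMap.fst ℝ ℝ ℝ +
        evalEval z.1 z.2 (derivative q) • ContinuousLinearMap.snd ℝ ℝ ℝ) z := by
  induction q using Polynomial.induction_on' with
  | add p q hp hq =>
    have e : (fun w : ℝ × ℝ => evalEval w.1 w.2 (p + q)) =
        (fun w => evalEval w.1 w.2 p) + fun w => evalEval w.1 w.2 q := by
      ext w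
      simp
    rw [e]
    refine (hp.add hq).congr_fderiv ?_
    rw [derivX_add, derivative_add, evalEval_add, evalEval_add]
    module
  | monomial n a =>
    have h1 : HasStrictFDerivAt (fun w : ℝ × ℝ => a.eval w.1)
        ((derivative a).eval z.1 • ContinuousLinearMap.fst ℝ ℝ ℝ) z :=
      (a.hasStrictDerivAt z.1).comp_hasStrictFDerivAt z hasStrictFDerivAt_fst
    have h2 : HasStrictFDerivAt (fun w : ℝ × ℝ => w.2 ^ n)
        (((n : ℝ) * z.2 ^ (n - 1)) • ContinuousLinearMap.snd ℝ ℝ ℝ) z :=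
      (hasStrictDerivAt_pow n z.2).comp_hasStrictFDerivAt z hasStrictFDerivAt_snd
    have e : (fun w : ℝ × ℝ => evalEval w.1 w.2 (monomial n a)) =
        fun w => a.eval w.1 * w.2 ^ n := by
      ext w
      simp [evalEval]
    rw [e]
    refine (h1.mul h2).congr_fderiv ?_
    ext <;> simp [derivX_monomial, derivative_monomial, evalEval] <;> ring

@[fun_prop]
lemma continuous_evalEval (q : ℝ[X][Y]) : Continuous fun w : ℝ × ℝ => evalEval w.1 w.2 q :=
  continuous_iff_continuousAt.2 fun z => (hasStrictFDerivAt_evalEval q z).continuousAt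

lemma hasDerivAt_evalEval_comp (q : ℝ[X][Y]) {f g : ℝ → ℝ} {f' g' t : ℝ} (hf : HasDerivAt f f' t)
    (hg : HasDerivAt g g' t) : HasDerivAt (fun s => evalEval (f s) (g s) q)
      (evalEval (f t) (g t) (derivX q) * f' + evalEval (f t) (g t) (derivative q) * g') t := by
  have := (hasStrictFDerivAt_evalEval q (f t, g t)).hasFDerivAt.comp_hasDerivAt t (hf.prodMk hg)
  exact this.congr_deriv (by simp)

lemma hasDerivAt_evalEval_snd (q : ℝ[X][Y]) (x t : ℝ) :
    HasDerivAt (fun s => evalEval x s q) (evalEval x t (derivative q)) t := by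
  simpa using hasDerivAt_evalEval_comp q (hasDerivAt_const t x) (hasDerivAt_id t)

lemma exists_branch {v : ℝ[X][Y]} {x₀ y₀ : ℝ} (hv : evalEval x₀ y₀ v = 0)
    (hvy : evalEval x₀ y₀ (derivative v) ≠ 0) : ∃ (y : ℝ → ℝ) (m : ℝ), y x₀ = y₀ ∧
      HasDerivAt y m x₀ ∧ (∀ᶠ x in 𝓝 x₀, evalEval x (y x) v = 0) ∧
      evalEval x₀ y₀ (derivX v) + evalEval x₀ y₀ (derivative v) * m = 0 := by
  have hf := hasStrictFDerivAt_evalEval v (x₀, y₀)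
  set f' := (evalEval (x₀, y₀).1 (x₀, y₀).2 (derivX v) • ContinuousLinearMap.fst ℝ ℝ ℝ +
        evalEval (x₀, y₀).1 (x₀, y₀).2 (derivative v) • ContinuousLinearMap.snd ℝ ℝ ℝ) with hf'
  have hinv : (f' ∘L .inr ℝ ℝ ℝ).IsInvertible := by
    refine ⟨ContinuousLinearEquiv.unitsEquivAut ℝ (Units.mk0 _ hvy), ?_⟩
    ext
    simp [f']
  have hy := (hf.hasStrictFDerivAt_implicitFunctionOfProdDomain hinv).hasFDerivAt.hasDerivAt
  have hev := hf.eventually_apply_implicitFunctionOfProdDomain hinv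
  have hself := (hf.eventually_apply_eq_iff_implicitFunctionOfProdDomain hinv).self_of_nhds
  set y := hf.implicitFunctionOfProdDomain hinv
  have hy0 : y x₀ = y₀ := hself.1 rfl
  have hev' : ∀ᶠ x in 𝓝 x₀, evalEval x (y x) v = 0 := by
    filter_upwards [hev] with x hx
    rw [hx, hv]
  refine ⟨y, _, hy0, hy, hev', ?_⟩
  have h1 := hasDerivAt_evalEval_comp v (hasDerivAt_id x₀) hy
  have h2 : HasDerivAt (fun s => evalEval (id s) (y s) v) 0 x₀ :=
    (hasDerivAt_const x₀ (0 : ℝ)).congr_of_eventuallyEq hev'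
  have := h1.unique h2
  simpa [hy0] using this

lemma exists_root_bound {p : ℝ[X][Y]} (hp : p.Monic) :
    ∃ A : ℝ, ∀ x ∈ Icc (0 : ℝ) 1, ∀ y, evalEval x y p = 0 → |y| ≤ A := by
  have hc : Continuous fun x : ℝ => ∑ i ∈ Finset.range p.natDegree, ‖(p.coeff i).eval x‖₊ := by
    fun_prop
  obtain ⟨T, hT⟩ := (isCompact_Icc (a := (0 : ℝ)) (b := 1)).bddAbove_image hc.continuousOn
  refine ⟨T + 1, fun x hx y hy => ?_⟩
  have hm : (p.map (evalRingHom x)).Monic := hp.map _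
  have hroot : (p.map (evalRingHom x)).IsRoot y := by
    rw [IsRoot, map_evalRingHom_eval, hy]
  have hlt := hroot.norm_lt_cauchyBound hm.ne_zero
  have hb : (p.map (evalRingHom x)).cauchyBound ≤ T + 1 := by
    rw [cauchyBound, hm.leadingCoeff, nnnorm_one, div_one, hp.natDegree_map]
    gcongr
    refine le_trans (Finset.sup_le fun i hi => ?_) (hT (mem_image_of_mem _ hx))
    rw [coeff_map, coe_evalRingHom]
    exact Finset.single_le_sum (f := fun i => ‖(p.coeff i).eval x‖₊) (fun _ _ => zero_le) hi
  exact_mod_cast (hlt.trans_le hb).le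

lemma isCompact_curve {p : ℝ[X][Y]} (hp : p.Monic) {a b : ℝ} (ha : 0 ≤ a) (hb : b ≤ 1) :
    IsCompact {z : ℝ × ℝ | z.1 ∈ Icc a b ∧ evalEval z.1 z.2 p = 0} := by
  obtain ⟨A, hA⟩ := exists_root_bound hp
  refine ((isCompact_Icc (a := a) (b := b)).prod (isCompact_Icc (a := -A) (b := A))).of_isClosed_subset
    ?_ ?_
  · exact (isClosed_Icc.preimage continuous_fst).inter
      (isClosed_singleton.preimage (continuous_evalEval p))
  · rintro ⟨x, y⟩ ⟨hx, hy⟩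
    exact ⟨hx, abs_le.1 (hA x ⟨ha.trans hx.1, hx.2.trans hb⟩ y hy)⟩

lemma exists_pow_le_abs_eval {R : ℝ[X]} (hR : R ≠ 0) {M : ℕ} (hM : R.natDegree ≤ M) :
    ∃ c > 0, ∃ δ > 0, ∀ x : ℝ, 0 < x → x < δ → c * x ^ M ≤ |R.eval x| := by
  obtain ⟨S, hS, hS0⟩ := exists_eq_pow_rootMultiplicity_mul_and_not_dvd R hR 0
  set m := R.rootMultiplicity 0
  have hmM : m ≤ M := by
    refine le_trans ?_ hM
    have := natDegree_le_of_dvd ⟨S, hS⟩ hR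
    rwa [natDegree_pow, natDegree_X_sub_C, mul_one] at this
  rw [dvd_iff_isRoot, IsRoot] at hS0
  have hpos : 0 < |S.eval 0| := abs_pos.2 hS0
  have hev : ∀ᶠ x in 𝓝 (0 : ℝ), |S.eval 0| / 2 < |S.eval x| :=
    (S.continuous.abs.tendsto 0).eventually_const_lt (by linarith)
  obtain ⟨δ, hδ, hδ'⟩ := Metric.eventually_nhds_iff.1 hev
  refine ⟨|S.eval 0| / 2, by positivity, min δ 1, by positivity, fun x hx hxδ => ?_⟩
  have h1 := hδ' (y := x) (by
    rw [Real.dist_eq, sub_zero, abs_of_pos hx]; exact hxδ.trans_le (min_le_left _ _))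
  have hx1 : x ≤ 1 := (hxδ.trans_le (min_le_right _ _)).le
  rw [hS]
  simp only [map_zero, sub_zero, eval_mul, eval_pow, eval_X, abs_mul, abs_pow, abs_of_pos hx]
  rw [mul_comm]
  gcongr ?_ * ?_
  exact pow_le_pow_of_le_one hx.le hx1 hmM

lemma exists_lower_bound_on_curve {p q : ℝ[X][Y]} (hp : p.Monic) (hpD : TotalDegLE p p.natDegree)
    (hpr : Prime p) {n : ℕ} (hq : TotalDegLE q n) (hpq : ¬ p ∣ q) :
    ∃ c > 0, ∃ δ > 0, ∀ x y : ℝ, 0 < x → x < δ → evalEval x y p = 0 →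
      c * x ^ (p.natDegree * n) ≤ |evalEval x y q| := by
  obtain ⟨R, a, u, hR, hRd, hRe⟩ := exists_eliminant hp hpD hpr hq hpq
  obtain ⟨c, hc, δ, hδ, hle⟩ := exists_pow_le_abs_eval hR hRd
  obtain ⟨A, hA⟩ := (isCompact_curve hp le_rfl le_rfl).bddAbove_image
    (continuous_evalEval a).abs.continuousOn
  refine ⟨c / (|A| + 1), by positivity, min δ 1, by positivity, fun x y hx hxδ hxy => ?_⟩
  have h1 := hle x hx (hxδ.trans_le (min_le_left _ _))
  have h2 : |evalEval x y a| ≤ A := hA ⟨(x, y),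
    ⟨⟨hx.le, (hxδ.trans_le (min_le_right _ _)).le⟩, hxy⟩, rfl⟩
  have h3 := congrArg (evalEval x y) hRe
  rw [evalEval_mul, evalEval_add, evalEval_mul, hxy, zero_mul, zero_add, evalEval_C] at h3
  rw [← h3, abs_mul] at h1
  rw [div_mul_eq_mul_div, div_le_iff₀ (by positivity)]
  refine h1.trans ?_
  gcongr
  exact h2.trans ((le_abs_self A).trans (by linarith))

lemma curve_induction {W : ℝ[X][Y]} {w : ℝ} (hw : w ≠ 0) (hlc : W.leadingCoeff = C w)
    (hWD : TotalDegLE W W.natDegree) {Q : Set (ℝ × ℝ) → Prop} (hempty : Q ∅)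
    (hunion : ∀ S T, Q S → Q T → Q (S ∪ T))
    (hprime : ∀ v : ℝ[X][Y], v.Monic → Prime v → TotalDegLE v v.natDegree → v ∣ W →
      Q {z | evalEval z.1 z.2 v = 0}) : Q {z | evalEval z.1 z.2 W = 0} := by
  have hunit : ∀ r : ℝ, r ≠ 0 → IsUnit (C (C r) : ℝ[X][Y]) := fun r hr =>
    ((isUnit_iff_ne_zero.2 hr).map C).map C
  have key : ∀ p : ℝ[X][Y], Prime p → p ∣ W → Q {z | evalEval z.1 z.2 p = 0} := by
    rintro p hp ⟨u, hu⟩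
    have hlc' : p.leadingCoeff * u.leadingCoeff = C w := by rw [← leadingCoeff_mul, ← hu, hlc]
    have hCw : IsUnit (C w : ℝ[X]) := (isUnit_iff_ne_zero.2 hw).map C
    obtain ⟨r, hr, hr'⟩ := isUnit_iff.1 (isUnit_of_mul_isUnit_left (hlc' ▸ hCw))
    obtain ⟨t, ht, ht'⟩ := isUnit_iff.1 (isUnit_of_mul_isUnit_right (hlc' ▸ hCw))
    have hr0 := hr.ne_zero
    have ht0 := ht.ne_zero
    have hv : (C (C r⁻¹) * p).Monic := by
      rw [Monic, leadingCoeff_mul, leadingCoeff_C, ← hr', ← C_mul, inv_mul_cancel₀ hr0, C_1]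
    have hu' : (C (C t⁻¹) * u).Monic := by
      rw [Monic, leadingCoeff_mul, leadingCoeff_C, ← ht', ← C_mul, inv_mul_cancel₀ ht0, C_1]
    have hass : Associated (C (C r⁻¹) * p) p :=
      associated_unit_mul_left p _ (hunit _ (inv_ne_zero hr0))
    have hprod : (C (C r⁻¹) * p) * (C (C t⁻¹) * u) = C (C (r⁻¹ * t⁻¹)) * W := by
      rw [hu, C_mul, C_mul]
      ring
    have hdeg : (C (C (r⁻¹ * t⁻¹)) * W).natDegree = W.natDegree :=
      natDegree_C_mul (C_ne_zero.2 (by positivity))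
    have := hprime _ hv (hass.prime_iff.2 hp) (TotalDegLE.of_mul hv hu' (by
      rw [hprod, hdeg]
      simpa using (TotalDegLE.real (r⁻¹ * t⁻¹)).mul hWD)) (hass.dvd.trans ⟨u, hu⟩)
    convert this using 2
    ext z
    simp [hr0]
  suffices ∀ a : ℝ[X][Y], a ≠ 0 → a ∣ W → Q {z | evalEval z.1 z.2 a = 0} from
    this W (fun h => by
      rw [h, leadingCoeff_zero] at hlc
      exact hw (C_eq_zero.1 hlc.symm)) dvd_rfl
  intro a
  induction a using UniqueFactorizationMonoid.induction_on_prime with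
  | h₁ => exact fun h => absurd rfl h
  | h₂ a ha =>
    intro _ _
    convert hempty
    ext z
    simpa using (ha.map (evalEvalRingHom z.1 z.2)).ne_zero
  | h₃ a p ha hp ih =>
    intro _ hd
    convert hunion _ _ (key p hp ((dvd_mul_right p a).trans hd)) (ih ha ((dvd_mul_left a p).trans hd))
    ext z
    simp

lemma TotalDegLE.coeff_eq_zero {q : ℝ[X][Y]} {n : ℤ} (h : TotalDegLE q n) {i : ℕ} (hi : n < i) :
    q.coeff i = 0 := by
  ext m
  exact h i m (by omega)

lemma TotalDegLE.natDegree_le {q : ℝ[X][Y]} {n : ℕ} (h : TotalDegLE q n) : q.natDegree ≤ n :=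
  natDegree_le_iff_coeff_eq_zero.2 fun _ hi => h.coeff_eq_zero (by exact_mod_cast hi)

lemma TotalDegLE.natDegree_eq {q : ℝ[X][Y]} {n : ℕ} (h : TotalDegLE q n) (hn : q.coeff n ≠ 0) :
    q.natDegree = n :=
  le_antisymm h.natDegree_le (le_natDegree_of_ne_zero hn)

lemma not_dvd_derivative {v : ℝ[X][Y]} (hv : Prime v) (hm : v.Monic) : ¬ v ∣ derivative v := by
  intro h
  have hd : 0 < v.natDegree := by
    rw [Nat.pos_iff_ne_zero]
    intro h0
    exact hv.not_isUnit (by rw [hm.natDegree_eq_zero.1 h0]; exact isUnit_one)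
  refine hm.not_dvd_of_natDegree_lt (fun h0 => ?_) (natDegree_derivative_lt hd.ne') h
  exact hd.ne' (derivative_eq_zero.1 h0)

lemma eventually_ne_zero_on_curve {p q : ℝ[X][Y]} (hp : p.Monic)
    (hpD : TotalDegLE p p.natDegree) (hpr : Prime p) {n : ℕ} (hq : TotalDegLE q n)
    (hpq : ¬ p ∣ q) :
    ∃ δ > 0, ∀ x y : ℝ, 0 < x → x < δ → evalEval x y p = 0 → evalEval x y q ≠ 0 := by
  obtain ⟨c, hc, δ, hδ, h⟩ := exists_lower_bound_on_curve hp hpD hpr hq hpq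
  refine ⟨δ, hδ, fun x y hx hxδ hxy => ?_⟩
  have := h x y hx hxδ hxy
  rw [← abs_pos]
  exact lt_of_lt_of_le (by positivity) this

lemma evalEval_eq_zero_of_dvd {p q : ℝ[X][Y]} (h : p ∣ q) {x y : ℝ} (hp : evalEval x y p = 0) :
    evalEval x y q = 0 := by
  obtain ⟨r, rfl⟩ := h
  rw [evalEval_mul, hp, zero_mul]

lemma exists_lower_bound_on_polar_component {v F : ℝ[X][Y]} (hm : v.Monic) (hv : Prime v)
    (hvD : TotalDegLE v v.natDegree) {n : ℕ} (hF : TotalDegLE F (n + 1 : ℕ))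
    (hvF : v ∣ derivative F) : ∃ c > 0, ∃ δ > 0, ∀ x y : ℝ, 0 < x → x < δ →
      evalEval x y v = 0 → evalEval x y F = 0 ∨
        c * x ^ (v.natDegree * n + 1) ≤ |evalEval x y F| := by
  by_cases hdvd : v ∣ F
  · exact ⟨1, one_pos, 1, one_pos, fun x y _ _ h => .inl (evalEval_eq_zero_of_dvd hdvd h)⟩
  set M := v.natDegree * n with hM
  have hFx : TotalDegLE (derivX F) n := by simpa using hF.derivX
  obtain ⟨c₁, hc₁, δ₁, hδ₁, h₁⟩ := exists_lower_bound_on_curve hm hvD hv hF hdvd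
  obtain ⟨δ₂, hδ₂, h₂⟩ := eventually_ne_zero_on_curve hm hvD hv
    (n := v.natDegree) (hvD.derivative.mono (by omega)) (not_dvd_derivative hv hm)
  obtain ⟨c₃, hc₃, δ₃, hδ₃, h₃⟩ : ∃ c > 0, ∃ δ > 0, ∀ x y : ℝ, 0 < x → x < δ →
      evalEval x y v = 0 → evalEval x y (derivX F) = 0 ∨ c * x ^ M ≤ |evalEval x y (derivX F)| := by
    by_cases hx : v ∣ derivX F
    · exact ⟨1, one_pos, 1, one_pos, fun x y _ _ h => .inl (evalEval_eq_zero_of_dvd hx h)⟩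
    · obtain ⟨c, hc, δ, hδ, h⟩ := exists_lower_bound_on_curve hm hvD hv hFx hx
      exact ⟨c, hc, δ, hδ, fun x y h1 h2 h3 => .inr (h x y h1 h2 h3)⟩
  obtain ⟨δ, hδ, hlt⟩ : ∃ δ : ℝ, 0 < δ ∧ δ < min (min δ₁ δ₂) (min δ₃ 1) :=
    exists_between (by positivity)
  simp only [lt_min_iff] at hlt
  obtain ⟨⟨hδδ₁, hδδ₂⟩, hδδ₃, hδ1⟩ := hlt
  obtain ⟨c, hc, hlt⟩ : ∃ c : ℝ, 0 < c ∧
      c < min (c₃ / (M + 1 : ℝ)) (c₁ * δ ^ (v.natDegree * (n + 1))) :=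
    exists_between (by positivity)
  rw [lt_min_iff, lt_div_iff₀ (by positivity)] at hlt
  obtain ⟨hcc₃, hcμ⟩ := hlt
  refine ⟨c, hc, δ, hδ, fun x y hx hxδ hxy => .inr ?_⟩
  have hK := isCompact_curve hm le_rfl hδ1.le
  set K := {z : ℝ × ℝ | z.1 ∈ Icc 0 δ ∧ evalEval z.1 z.2 v = 0} with hKdef
  have hgc : Continuous fun z : ℝ × ℝ => |evalEval z.1 z.2 F| - c * z.1 ^ (M + 1) := by fun_prop
  have hmem : (x, y) ∈ K := ⟨⟨hx.le, hxδ.le⟩, hxy⟩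
  obtain ⟨⟨x₀, y₀⟩, ⟨⟨hx₀, hx₀δ⟩, hv₀⟩, hmin⟩ := hK.exists_isMinOn ⟨_, hmem⟩ hgc.continuousOn
  dsimp only at hx₀ hx₀δ hv₀
  have hle := isMinOn_iff.1 hmin _ hmem
  dsimp only at hle
  suffices 0 ≤ |evalEval x₀ y₀ F| - c * x₀ ^ (M + 1) by linarith
  rcases hx₀.eq_or_lt with rfl | hx₀
  · simp
  rcases hx₀δ.eq_or_lt with rfl | hx₀δ
  · have := h₁ _ _ hδ hδδ₁ hv₀
    have h5 : c * x₀ ^ (M + 1) ≤ c := mul_le_of_le_one_right hc.le (pow_le_one₀ hδ.le hδ1.le)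
    linarith
  exfalso
  have hF₀ : evalEval x₀ y₀ F ≠ 0 := by
    rw [← abs_pos]
    exact lt_of_lt_of_le (by positivity) (h₁ x₀ y₀ hx₀ (hx₀δ.trans hδδ₁) hv₀)
  obtain ⟨b, m, hb, hbd, hbv, -⟩ := exists_branch hv₀ (h₂ x₀ y₀ hx₀ (hx₀δ.trans hδδ₂) hv₀)
  have hFy : evalEval x₀ y₀ (derivative F) = 0 := evalEval_eq_zero_of_dvd hvF hv₀
  have hd1 : HasDerivAt (fun s => evalEval s (b s) F) (evalEval x₀ y₀ (derivX F)) x₀ := by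
    have := hasDerivAt_evalEval_comp F (hasDerivAt_id x₀) hbd
    simpa [hb, hFy] using this
  have hd2 := (hasDerivAt_abs (x := evalEval x₀ (b x₀) F) (by rwa [hb])).comp x₀ hd1
  have hd3 := hd2.sub ((hasDerivAt_pow (M + 1) x₀).const_mul c)
  have hlocal : IsLocalMin ((abs ∘ fun s => evalEval s (b s) F) - fun s => c * s ^ (M + 1)) x₀ := by
    filter_upwards [hbv, Ioo_mem_nhds hx₀ hx₀δ] with s hs hs'
    have := isMinOn_iff.1 hmin (s, b s) ⟨⟨hs'.1.le, hs'.2.le⟩, hs⟩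
    simpa [hb] using this
  have h0 := hlocal.hasDerivAt_eq_zero hd3
  rw [hb] at h0
  have habs : |evalEval x₀ y₀ (derivX F)| = c * (M + 1) * x₀ ^ M := by
    rw [sub_eq_zero] at h0
    have := congrArg abs h0
    rw [abs_mul] at this
    have hs : |((SignType.sign (evalEval x₀ y₀ F) : SignType) : ℝ)| = 1 := by
      rcases hF₀.lt_or_gt with h | h <;> simp [h, sign_neg, sign_pos]
    rw [hs, one_mul, Nat.add_sub_cancel, abs_of_pos (a := c * _) (by positivity)] at this
    rw [this]
    push_cast
    ring
  have hpos : 0 < c * (M + 1) * x₀ ^ M := by positivity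
  rcases h₃ x₀ y₀ hx₀ (hx₀δ.trans hδδ₃) hv₀ with h | h
  · rw [h, abs_zero] at habs
    linarith
  · rw [habs] at h
    have := le_of_mul_le_mul_right h (by positivity)
    linarith

lemma exists_lower_bound_on_polar {F : ℝ[X][Y]} {n : ℕ} (hF : TotalDegLE F (n + 1 : ℕ)) {a : ℝ}
    (ha : a ≠ 0) (hFa : F.coeff (n + 1) = C a) : ∃ c > 0, ∃ δ > 0, ∀ x y : ℝ, 0 < x → x < δ →
      evalEval x y (derivative F) = 0 → evalEval x y F = 0 ∨
        c * x ^ (n ^ 2 + 1) ≤ |evalEval x y F| := by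
  have hD : TotalDegLE (derivative F) n := by simpa using hF.derivative
  have hco : (derivative F).coeff n = C (a * (n + 1)) := by
    rw [coeff_derivative, hFa]
    simp
  have hne : a * (n + 1) ≠ 0 := by positivity
  have hdeg := hD.natDegree_eq (by rw [hco]; exact C_ne_zero.2 hne)
  have := curve_induction (W := derivative F) hne (by rw [leadingCoeff, hdeg, hco])
    (by rwa [hdeg]) (Q := fun S => ∃ c > 0, ∃ δ > 0, ∀ z ∈ S, 0 < z.1 → z.1 < δ →
      evalEval z.1 z.2 F = 0 ∨ c * z.1 ^ (n ^ 2 + 1) ≤ |evalEval z.1 z.2 F|)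
    ⟨1, one_pos, 1, one_pos, by simp⟩ ?_ ?_
  · obtain ⟨c, hc, δ, hδ, h⟩ := this
    exact ⟨c, hc, δ, hδ, fun x y hx hxδ hxy => h (x, y) hxy hx hxδ⟩
  · rintro S T ⟨c, hc, δ, hδ, h⟩ ⟨c', hc', δ', hδ', h'⟩
    refine ⟨min c c', by positivity, min δ δ', by positivity, fun z hz hz0 hzδ => ?_⟩
    rw [lt_min_iff] at hzδ
    rcases hz with hz | hz
    · refine (h z hz hz0 hzδ.1).imp_right (le_trans ?_)
      gcongr
      exact min_le_left _ _
    · refine (h' z hz hz0 hzδ.2).imp_right (le_trans ?_)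
      gcongr
      exact min_le_right _ _
  · intro v hm hv hvD hdvd
    obtain ⟨c, hc, δ, hδ, h⟩ := exists_lower_bound_on_polar_component hm hv hvD hF hdvd
    refine ⟨c, hc, min δ 1, by positivity, fun z hz hz0 hzδ => ?_⟩
    rw [lt_min_iff] at hzδ
    refine (h z.1 z.2 hz0 hzδ.1 hz).imp_right (le_trans ?_)
    gcongr ?_ * ?_
    refine pow_le_pow_of_le_one hz0.le hzδ.2.le ?_
    have : v.natDegree ≤ n := by
      rw [← hdeg]
      refine natDegree_le_of_dvd hdvd fun h0 => hne ?_
      rw [h0, coeff_zero, eq_comm, C_eq_zero] at hco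
      exact hco
    nlinarith

lemma factorial_mul_leadingCoeff_le (p : ℝ[X]) (y : ℝ) {h M : ℝ} (hh : h ≠ 0)
    (hM : ∀ k ≤ p.natDegree, |p.eval (y + k * h)| ≤ M) :
    |p.leadingCoeff| * |h| ^ p.natDegree * p.natDegree.factorial ≤ 2 ^ p.natDegree * M := by
  set q := p.comp (C y + C h * X) with hq
  have hlin : (C y + C h * X).natDegree = 1 := by
    rw [add_comm]
    exact natDegree_linear hh
  have hqd : q.natDegree = p.natDegree := by rw [hq, natDegree_comp, hlin, mul_one]
  have hql : q.leadingCoeff = p.leadingCoeff * h ^ p.natDegree := by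
    have : (C y + C h * X).leadingCoeff = h := by
      rw [add_comm]
      exact leadingCoeff_linear hh
    rw [hq, leadingCoeff_comp (by omega), this]
  have h1 := congrFun q.fwdDiff_iter_degree_eq_factorial 0
  rw [fwdDiff_iter_eq_sum_shift, hqd, hql] at h1
  simp only [Pi.smul_apply, Pi.natCast_apply, smul_eq_mul] at h1
  have h2 := congrArg abs h1
  rw [abs_mul, abs_mul, abs_pow, Nat.abs_cast] at h2
  rw [← h2]
  refine (Finset.abs_sum_le_sum_abs _ _).trans ?_
  have h3 : (2 : ℝ) ^ p.natDegree * M =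
      ∑ k ∈ Finset.range (p.natDegree + 1), (p.natDegree.choose k : ℝ) * M := by
    rw [← Finset.sum_mul, ← Nat.cast_sum, Nat.sum_range_choose]
    push_cast
    rfl
  rw [h3]
  refine Finset.sum_le_sum fun k hk => ?_
  rw [zsmul_eq_mul, abs_mul]
  push_cast
  rw [abs_mul, abs_pow, abs_neg, abs_one, one_pow, one_mul, Nat.abs_cast]
  gcongr
  have := hM k (Nat.lt_succ_iff.1 (Finset.mem_range.1 hk))
  have e : q.eval (0 + k • (1 : ℝ)) = p.eval (y + k * h) := by
    rw [hq, eval_comp, zero_add, nsmul_one]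
    congr 1
    simp only [eval_add, eval_mul, eval_C, eval_X]
    ring
  rwa [e]

lemma exists_nearby_critical_point (d : ℕ) (hd : d ≠ 0) {a : ℝ} (ha : a ≠ 0) :
    ∃ κ > 0, ∀ p : ℝ[X], p.natDegree = d → p.leadingCoeff = a → ∀ y : ℝ, ∃ y' : ℝ,
      (p.eval y' = 0 ∨ (derivative p).eval y' = 0) ∧ |p.eval y'| ≤ |p.eval y| ∧
        κ * |y - y'| ^ d ≤ |p.eval y| := by
  have hd0 : (0 : ℝ) < d := by positivity
  refine ⟨|a| * d.factorial / (2 ^ (d + 1) * d ^ d), by positivity, fun p hpd hpa y => ?_⟩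
  by_cases hy : p.eval y = 0
  · exact ⟨y, .inl hy, le_rfl, by simp [hd]⟩
  have hm : 0 < |p.eval y| := abs_pos.2 hy
  set m := |p.eval y|
  set h := (2 ^ (d + 1) * m / (|a| * d.factorial)) ^ ((d : ℝ)⁻¹) with hh
  have hpow : h ^ d = 2 ^ (d + 1) * m / (|a| * d.factorial) :=
    Real.rpow_inv_natCast_pow (by positivity) hd
  have hpos : 0 < h := by positivity
  have key : ∀ s : ℝ, |s| = 1 → ∃ t : ℝ, 0 < t ∧ t ≤ d * h ∧ m < |p.eval (y + s * t)| := by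
    intro s hs
    have hs0 : s ≠ 0 := by
      rintro rfl
      simp at hs
    by_contra! hcon
    have := factorial_mul_leadingCoeff_le p y (mul_ne_zero hs0 hpos.ne') (M := m) fun k hk => by
      rcases Nat.eq_zero_or_pos k with rfl | hk0
      · simp [m]
      · have := hcon (k * h) (by positivity) (by gcongr; omega)
        rwa [mul_left_comm s] at this
    rw [hpa, hpd, abs_mul, hs, one_mul, abs_of_pos hpos, hpow] at this
    have e : |a| * (2 ^ (d + 1) * m / (|a| * d.factorial)) * d.factorial = 2 * (2 ^ d * m) := by
      field_simp
      ring
    rw [e] at this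
    have : 0 < 2 ^ d * m := by positivity
    linarith
  obtain ⟨t, ht, hth, hmt⟩ := key 1 (by simp)
  obtain ⟨u, hu, huh, hmu⟩ := key (-1) (by simp)
  have hyI : y ∈ Icc (y + -1 * u) (y + 1 * t) := ⟨by linarith, by linarith⟩
  obtain ⟨y', ⟨hy1, hy2⟩, hmin⟩ := isCompact_Icc.exists_isMinOn ⟨y, hyI⟩
    (p.continuous.abs.continuousOn)
  have hle : |p.eval y'| ≤ m := isMinOn_iff.1 hmin y hyI
  have hy1' : y + -1 * u < y' := hy1.lt_of_ne fun e => by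
    rw [e] at hmu
    linarith
  have hy2' : y' < y + 1 * t := hy2.lt_of_ne fun e => by
    rw [← e] at hmt
    linarith
  refine ⟨y', ?_, hle, ?_⟩
  · have hloc : IsLocalMin (fun s => p.eval s ^ 2) y' := by
      filter_upwards [Ioo_mem_nhds hy1' hy2'] with s hs
      exact sq_le_sq.2 (isMinOn_iff.1 hmin s ⟨hs.1.le, hs.2.le⟩)
    have h0 := hloc.hasDerivAt_eq_zero ((p.hasDerivAt y').pow 2)
    simpa using h0
  · have h1 : |y - y'| ≤ d * h := abs_le.2 ⟨by linarith, by linarith⟩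
    calc _ ≤ |a| * d.factorial / (2 ^ (d + 1) * d ^ d) * (d * h) ^ d := by gcongr
      _ = m := by
        rw [mul_pow, hpow]
        field_simp

lemma evalEval_eq_sum_range {q : ℝ[X][Y]} {n : ℕ} (hn : q.natDegree < n) (x y : ℝ) :
    evalEval x y q = ∑ i ∈ Finset.range n, (q.coeff i).eval x * y ^ i := by
  rw [← map_evalRingHom_eval, eval_eq_sum_range' (natDegree_map_le.trans_lt hn)]
  simp

lemma exists_lower_bound_atTop {p : ℝ[X]} (hp : p ≠ 0) :
    ∃ c > 0, ∀ᶠ w in atTop, c ≤ |p.eval w| := by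
  by_cases h : 0 < p.degree
  · exact ⟨1, one_pos, (p.abs_tendsto_atTop h).eventually_ge_atTop 1⟩
  · obtain ⟨r, rfl⟩ : ∃ r, p = C r := ⟨_, eq_C_of_degree_le_zero (not_lt.1 h)⟩
    exact ⟨|r|, abs_pos.2 fun h => hp (by rw [h, C_0]), by simp⟩

lemma root_bounded_or_large {A : ℝ[X][Y]} (hA : A ≠ 0) {e : ℕ} (he : A.natDegree ≤ e) :
    ∃ K > 0, ∃ δ > 0, ∀ x w : ℝ, 0 < x → x < δ → evalEval x w A = 0 →
      w ≤ K ∨ 1 ≤ x * w ^ (e + 1) := by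
  have hirr : Irreducible (C X : ℝ[X][Y]) := (prime_C_iff.2 prime_X).irreducible
  obtain ⟨μ, q, hq, hAq⟩ := WfDvdMonoid.max_power_factor hA hirr
  set p := q.map (evalRingHom 0) with hp
  have hp0 : p ≠ 0 := by
    intro h
    refine hq (C_dvd_iff_dvd_coeff _ _ |>.2 fun i => X_dvd_iff.2 ?_)
    have := congrArg (fun r => coeff r i) h
    simpa [hp, coeff_zero_eq_eval_zero] using this
  obtain ⟨r, hr⟩ : C X ∣ q - p.map C := by
    refine C_dvd_iff_dvd_coeff _ _ |>.2 fun i => X_dvd_iff.2 ?_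
    simp [hp, coeff_zero_eq_eval_zero]
  have hqe : q.natDegree ≤ e := by
    refine le_trans (natDegree_le_of_dvd ?_ hA) he
    exact ⟨_, hAq.trans (mul_comm _ _)⟩
  have hre : r.natDegree ≤ e := by
    have h1 : (C X * r : ℝ[X][Y]).natDegree = r.natDegree := natDegree_C_mul X_ne_zero
    rw [← h1, ← hr]
    refine (natDegree_sub_le _ _).trans (max_le hqe ?_)
    exact natDegree_map_le.trans (natDegree_map_le.trans hqe)
  obtain ⟨c, hc, hev⟩ := exists_lower_bound_atTop hp0
  obtain ⟨K₁, hK₁⟩ := eventually_atTop.1 hev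
  have hcont : Continuous fun x : ℝ => ∑ i ∈ Finset.range (e + 1), |(r.coeff i).eval x| := by
    fun_prop
  obtain ⟨T, hT⟩ := (isCompact_Icc (a := (0 : ℝ)) (b := 1)).bddAbove_image hcont.continuousOn
  refine ⟨max (max K₁ 1) (T / c), by positivity, 1, one_pos, fun x w hx hx1 h0 => ?_⟩
  refine or_iff_not_imp_left.2 fun hw => ?_
  simp only [not_le, max_lt_iff, div_lt_iff₀ hc] at hw
  obtain ⟨⟨hwK, hw1⟩, hwT⟩ := hw
  have h1 : evalEval x w q = 0 := by
    rw [hAq, evalEval_mul, evalEval_pow, evalEval_C, eval_X] at h0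
    exact (mul_eq_zero.1 h0).resolve_left (by positivity)
  have h2 : p.eval w = -(x * evalEval x w r) := by
    have := congrArg (evalEval x w) hr
    rw [evalEval_sub, evalEval_mul, evalEval_C, eval_X, h1, evalEval_map_C] at this
    linarith
  have h3 : |evalEval x w r| ≤ T * w ^ e := by
    rw [evalEval_eq_sum_range (Nat.lt_succ_of_le hre)]
    refine (Finset.abs_sum_le_sum_abs _ _).trans ?_
    calc _ ≤ ∑ i ∈ Finset.range (e + 1), |(r.coeff i).eval x| * w ^ e := by
          refine Finset.sum_le_sum fun i hi => ?_
          rw [abs_mul, abs_of_pos (a := w ^ i) (by positivity)]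
          gcongr
          · exact hw1.le
          · exact Nat.lt_succ_iff.1 (Finset.mem_range.1 hi)
      _ ≤ _ := by
          rw [← Finset.sum_mul]
          gcongr
          exact hT (mem_image_of_mem _ ⟨hx.le, hx1.le⟩)
  have h4 := hK₁ w hwK.le
  rw [h2, abs_neg, abs_mul, abs_of_pos hx] at h4
  have h5 : c ≤ c * (x * w ^ (e + 1)) := by
    calc c ≤ x * |evalEval x w r| := h4
      _ ≤ x * (T * w ^ e) := by gcongr
      _ ≤ x * ((w * c) * w ^ e) := by gcongr
      _ = _ := by ring
  exact le_of_mul_le_mul_left (by linarith) hc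

/-- The squared norm of the gradient of `F`. -/
noncomputable def gradSq (F : ℝ[X][Y]) : ℝ[X][Y] := derivX F ^ 2 + derivative F ^ 2

lemma evalEval_gradSq (F : ℝ[X][Y]) (x y : ℝ) : evalEval x y (gradSq F) =
    evalEval x y (derivX F) ^ 2 + evalEval x y (derivative F) ^ 2 := by
  simp [gradSq]

lemma gradSq_ratio_bounded_or_large {v : ℝ[X][Y]} (hm : v.Monic) (F : ℝ[X][Y]) :
    ∃ K > 0, ∃ δ > 0, ∀ x y : ℝ, 0 < x → x < δ → evalEval x y v = 0 → evalEval x y F ≠ 0 →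
      evalEval x y (gradSq F) / evalEval x y F ^ 2 ≤ K ∨
        1 ≤ x * (evalEval x y (gradSq F) / evalEval x y F ^ 2) ^ (v.natDegree + 1) := by
  set e := v.natDegree with he
  obtain ⟨a, ha, hdvd⟩ := exists_relation_mod hm fun k => gradSq F ^ (k : ℕ) * F ^ (2 * (e - k))
  set A : ℝ[X][Y] := ∑ k, C (a k) * X ^ (k : ℕ) with hA
  have hAc : ∀ k : Fin (e + 1), A.coeff (k : ℕ) = a k := by
    intro k
    rw [hA, finsetSum_coeff, Finset.sum_eq_single k]
    · simp
    · intro j _ hj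
      rw [coeff_C_mul_X_pow, if_neg]
      exact fun h => hj (Fin.ext h.symm)
    · simp
  have hA0 : A ≠ 0 := by
    intro h
    refine ha (funext fun k => ?_)
    rw [← hAc, h, coeff_zero, Pi.zero_apply]
  have hAd : A.natDegree ≤ e := natDegree_sum_le_of_forall_le _ _ fun k _ =>
    (natDegree_C_mul_X_pow_le _ _).trans (Nat.lt_succ_iff.1 k.2)
  obtain ⟨K, hK, δ, hδ, h⟩ := root_bounded_or_large hA0 hAd
  refine ⟨K, hK, δ, hδ, fun x y hx hxδ hxy hF => h x _ hx hxδ ?_⟩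
  have h0 := evalEval_eq_zero_of_dvd hdvd hxy
  rw [hA]
  rw [evalEval_finsetSum] at h0 ⊢
  have h1 : evalEval x y F ^ (2 * e) * ∑ k : Fin (e + 1), evalEval x
      (evalEval x y (gradSq F) / evalEval x y F ^ 2) (C (a k) * X ^ (k : ℕ)) = 0 := by
    rw [← h0, Finset.mul_sum]
    refine Finset.sum_congr rfl fun k _ => ?_
    simp only [evalEval_mul, evalEval_C, evalEval_pow, evalEval_X]
    have hk : 2 * e = 2 * (e - k) + 2 * k := by omega
    rw [hk, pow_add, pow_mul _ 2 (k : ℕ), div_pow]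
    field_simp
  exact (mul_eq_zero.1 h1).resolve_left (by positivity)

lemma derivX_eq_zero_or_not_dvd {v : ℝ[X][Y]} (hm : v.Monic) : derivX v = 0 ∨ ¬ v ∣ derivX v := by
  refine or_iff_not_imp_left.2 fun h0 => hm.not_dvd_of_degree_lt h0 ?_
  rw [degree_eq_natDegree hm.ne_zero]
  refine (degree_lt_iff_coeff_zero _ _).2 fun i hi => ?_
  rw [coeff_derivX]
  rcases hi.eq_or_lt with rfl | hi
  · rw [hm.coeff_natDegree, derivative_one]
  · rw [coeff_eq_zero_of_natDegree_lt hi, derivative_zero]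

lemma abs_add_mul_le {K a b m t f : ℝ} (hK : 0 ≤ K) (h : a ^ 2 + b ^ 2 ≤ K ^ 2 * f ^ 2)
    (ht : |m| ≤ t) : |a + b * m| ≤ K * |f| * (1 + t) := by
  have hf : 0 ≤ K * |f| := by positivity
  have h' : a ^ 2 + b ^ 2 ≤ (K * |f|) ^ 2 := by rwa [mul_pow, sq_abs]
  have ha : |a| ≤ K * |f| := abs_le_of_sq_le_sq (by nlinarith [sq_nonneg b]) hf
  have hb : |b| ≤ K * |f| := abs_le_of_sq_le_sq (by nlinarith [sq_nonneg a]) hf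
  calc |a + b * m| ≤ |a| + |b| * |m| := (abs_add_le _ _).trans_eq (by rw [abs_mul])
    _ ≤ K * |f| + K * |f| * t := by gcongr
    _ = _ := by ring

lemma exists_gradSq_ratio_large {v F : ℝ[X][Y]} (hm : v.Monic) (hv : Prime v)
    (hvD : TotalDegLE v v.natDegree) {d : ℕ} (hF : TotalDegLE F d) (hvF : ¬ v ∣ F) :
    ∃ η > 0, ∃ δ > 0, ∀ x y : ℝ, 0 < x → x < δ → evalEval x y v = 0 → |evalEval x y F| < η →
      1 ≤ x * (evalEval x y (gradSq F) / evalEval x y F ^ 2) ^ (v.natDegree + 1) := by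
  set n := v.natDegree + 1 with hn
  obtain ⟨c₁, hc₁, δ₁, hδ₁, h₁⟩ := exists_lower_bound_on_curve hm hvD hv hF hvF
  obtain ⟨δ₂, hδ₂, h₂⟩ := eventually_ne_zero_on_curve hm hvD hv
    (n := v.natDegree) (hvD.derivative.mono (by omega)) (not_dvd_derivative hv hm)
  obtain ⟨δ₃, hδ₃, h₃⟩ : ∃ δ > 0, derivX v = 0 ∨ ∀ x y : ℝ, 0 < x → x < δ → evalEval x y v = 0 →
      evalEval x y (derivX v) ≠ 0 := by
    rcases derivX_eq_zero_or_not_dvd hm with h | h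
    · exact ⟨1, one_pos, .inl h⟩
    · obtain ⟨δ, hδ, h⟩ := eventually_ne_zero_on_curve hm hvD hv
        (n := v.natDegree) (hvD.derivX.mono (by omega)) h
      exact ⟨δ, hδ, .inr h⟩
  obtain ⟨K, hK, δ₄, hδ₄, h₄⟩ := gradSq_ratio_bounded_or_large hm F
  have hFne : ∀ x y, 0 < x → x < δ₁ → evalEval x y v = 0 → evalEval x y F ≠ 0 := by
    intro x y hx hxδ hxy
    rw [← abs_pos]
    exact lt_of_lt_of_le (by positivity) (h₁ x y hx hxδ hxy)
  obtain ⟨T, hT⟩ := exists_root_bound hm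
  obtain ⟨δ, hδ, hlt⟩ : ∃ δ : ℝ, 0 < δ ∧
      δ < min (min (min δ₁ δ₂) (min δ₃ δ₄)) (min 1 (1 / (K + 1) ^ n)) :=
    exists_between (by positivity)
  simp only [lt_min_iff] at hlt
  obtain ⟨⟨⟨hδδ₁, hδδ₂⟩, hδδ₃, hδδ₄⟩, hδ1, hδK⟩ := hlt
  have hwlt : ∀ x y, 0 < x → x < δ → evalEval x y v = 0 →
      evalEval x y (gradSq F) / evalEval x y F ^ 2 < K + 1 →
      evalEval x y (gradSq F) / evalEval x y F ^ 2 ≤ K := by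
    intro x y hx hxδ hxy hw
    refine (h₄ x y hx (hxδ.trans hδδ₄) hxy (hFne x y hx (hxδ.trans hδδ₁) hxy)).resolve_right ?_
    rw [not_le]
    have hw0 : 0 ≤ evalEval x y (gradSq F) / evalEval x y F ^ 2 := by
      rw [evalEval_gradSq]
      positivity
    calc _ ≤ x * (K + 1) ^ n := by gcongr
      _ < 1 := by rw [← lt_div_iff₀ (by positivity)]; linarith
  set κ := √K with hκ
  have hκK : κ ^ 2 = K := Real.sq_sqrt hK.le
  set A := κ + 1 with hA
  have hκ0 : 0 ≤ κ := Real.sqrt_nonneg _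
  have hT0 : T ≤ |T| := le_abs_self T
  set μ := c₁ * δ ^ (v.natDegree * d)
  have hμ : 0 < μ := by positivity
  refine ⟨Real.exp (Real.log μ - A * (1 + 2 * |T|)), Real.exp_pos _, δ, hδ,
    fun x₀ y₀ hx₀ hx₀δ hv₀ hFη => ?_⟩
  have hF₀ := hFne x₀ y₀ hx₀ (hx₀δ.trans hδδ₁) hv₀
  refine (h₄ x₀ y₀ hx₀ (hx₀δ.trans hδδ₄) hv₀ hF₀).resolve_left fun hbad => ?_
  refine hFη.not_ge ?_
  rw [← Real.le_log_iff_exp_le (abs_pos.2 hF₀), Real.log_abs]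
  obtain ⟨s, hs, hs₀⟩ : ∃ s : ℝ, |s| = 1 ∧
      s * (evalEval x₀ y₀ (derivX v) * evalEval x₀ y₀ (derivative v)) ≤ 0 := by
    rcases le_total 0 (evalEval x₀ y₀ (derivX v) * evalEval x₀ y₀ (derivative v)) with h | h
    · exact ⟨-1, by simp, by linarith⟩
    · exact ⟨1, by simp, by linarith⟩
  set S : Set (ℝ × ℝ) := {z | z.1 ∈ Icc x₀ δ ∧ evalEval z.1 z.2 v = 0} ∩
    ({z | evalEval z.1 z.2 (gradSq F) ≤ K * evalEval z.1 z.2 F ^ 2} ∩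
    {z | s * (evalEval z.1 z.2 (derivX v) * evalEval z.1 z.2 (derivative v)) ≤ 0}) with hS
  have hSc : IsCompact S := by
    refine (isCompact_curve hm hx₀.le hδ1.le).inter_right (IsClosed.inter ?_ ?_)
    · exact isClosed_le (by fun_prop) (by fun_prop)
    · exact isClosed_le (by fun_prop) (by fun_prop)
  have hmem : (x₀, y₀) ∈ S := by
    refine ⟨⟨⟨le_rfl, hx₀δ.le⟩, hv₀⟩, ?_, hs₀⟩
    rwa [div_le_iff₀ (by positivity)] at hbad
  have hSne : ∀ z ∈ S, evalEval z.1 z.2 F ≠ 0 := fun z hz =>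
    hFne _ _ (hx₀.trans_le hz.1.1.1) (hz.1.1.2.trans_lt hδδ₁) hz.1.2
  have hgc : ContinuousOn (fun z : ℝ × ℝ => Real.log (evalEval z.1 z.2 F) - A * (z.1 + s * z.2))
      S := by
    refine ContinuousOn.sub ?_ (by fun_prop)
    exact (continuous_evalEval F).continuousOn.log hSne
  obtain ⟨⟨x₁, y₁⟩, hz₁, hmin⟩ := hSc.exists_isMinOn ⟨_, hmem⟩ hgc
  have hle := isMinOn_iff.1 hmin _ hmem
  dsimp only at hle
  have hF₁ := hSne _ hz₁
  obtain ⟨⟨⟨hx₁, hx₁δ⟩, hv₁⟩, hw₁, hs₁⟩ := hz₁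
  dsimp only at hF₁ hx₁ hx₁δ hv₁
  replace hw₁ : evalEval x₁ y₁ (gradSq F) ≤ K * evalEval x₁ y₁ F ^ 2 := hw₁
  replace hs₁ : s * (evalEval x₁ y₁ (derivX v) * evalEval x₁ y₁ (derivative v)) ≤ 0 := hs₁
  have hx₁0 : 0 < x₁ := hx₀.trans_le hx₁
  rcases hx₁δ.eq_or_lt with rfl | hx₁δ
  · have hlog : Real.log μ ≤ Real.log (evalEval x₁ y₁ F) := by
      rw [← Real.log_abs (evalEval x₁ y₁ F)]
      exact Real.log_le_log hμ (h₁ _ _ hδ hδδ₁ hv₁)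
    have hy : s * y₁ - s * y₀ ≤ 2 * |T| := by
      have h5 : |s * y₁| ≤ T := by
        rw [abs_mul, hs, one_mul]
        exact hT _ ⟨hδ.le, hδ1.le⟩ _ hv₁
      have h6 : |s * y₀| ≤ T := by
        rw [abs_mul, hs, one_mul]
        exact hT _ ⟨hx₀.le, (hx₀δ.trans hδ1).le⟩ _ hv₀
      have := (abs_le.1 h5).2
      have := (abs_le.1 h6).1
      linarith
    have : A * (x₁ + s * y₁ - (x₀ + s * y₀)) ≤ A * (1 + 2 * |T|) := by
      gcongr
      linarith
    linarith
  exfalso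
  have hvy := h₂ x₁ y₁ hx₁0 (hx₁δ.trans hδδ₂) hv₁
  obtain ⟨b, m, hb, hbd, hbv, hbm⟩ := exists_branch hv₁ hvy
  have hcb : ContinuousAt (fun x => (x, b x)) x₁ := continuousAt_id.prodMk hbd.continuousAt
  have hsm : |m| ≤ s * m := by
    have h5 : evalEval x₁ y₁ (derivX v) = -(evalEval x₁ y₁ (derivative v) * m) := by linarith
    have h6 : 0 ≤ s * m := by
      have h7 : 0 ≤ (s * m) * evalEval x₁ y₁ (derivative v) ^ 2 := by
        rw [h5] at hs₁
        linarith
      exact nonneg_of_mul_nonneg_left h7 (by positivity)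
    rw [← abs_of_nonneg h6, abs_mul, hs, one_mul]
  have hd1 : HasDerivAt (fun t => evalEval t (b t) F)
      (evalEval x₁ y₁ (derivX F) + evalEval x₁ y₁ (derivative F) * m) x₁ := by
    have := hasDerivAt_evalEval_comp F (hasDerivAt_id x₁) hbd
    simpa [hb] using this
  have hd2 := (hd1.log (by rwa [hb])).sub
    (((hasDerivAt_id x₁).add (hbd.const_mul s)).const_mul A)
  have hneg : (evalEval x₁ y₁ (derivX F) + evalEval x₁ y₁ (derivative F) * m) /
      evalEval x₁ (b x₁) F - A * (1 + s * m) < 0 := by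
    have h5 : |evalEval x₁ y₁ (derivX F) + evalEval x₁ y₁ (derivative F) * m| ≤
        κ * |evalEval x₁ y₁ F| * (1 + s * m) := by
      refine abs_add_mul_le hκ0 ?_ hsm
      rw [← evalEval_gradSq, hκK]
      exact hw₁
    have h6 : (evalEval x₁ y₁ (derivX F) + evalEval x₁ y₁ (derivative F) * m) /
        evalEval x₁ y₁ F ≤ κ * (1 + s * m) := by
      refine (le_abs_self _).trans ?_
      rw [abs_div, div_le_iff₀ (abs_pos.2 hF₁)]
      linarith
    have h7 : 0 ≤ s * m := (abs_nonneg m).trans hsm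
    rw [hb, hA]
    linarith
  have hev : ∀ᶠ x in 𝓝 x₁, x₀ ≤ x → (x, b x) ∈ S := by
    have hc1 : ContinuousAt (fun x => evalEval x (b x) (gradSq F) / evalEval x (b x) F ^ 2) x₁ := by
      refine ContinuousAt.div ?_ ?_ (by rw [hb]; positivity)
      · exact (continuous_evalEval (gradSq F)).continuousAt.comp hcb
      · exact ((continuous_evalEval F).continuousAt.comp hcb).pow 2
    have e1 : ∀ᶠ x in 𝓝 x₁, evalEval x (b x) (gradSq F) / evalEval x (b x) F ^ 2 < K + 1 := by
      refine hc1.eventually_lt_const ?_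
      simp only [hb]
      refine lt_of_le_of_lt ?_ (lt_add_one K)
      rwa [div_le_iff₀ (by positivity)]
    have e2 : ∀ᶠ x in 𝓝 x₁,
        s * (evalEval x (b x) (derivX v) * evalEval x (b x) (derivative v)) ≤ 0 := by
      rcases h₃ with h | h
      · simp [h]
      · have hc2 : ContinuousAt (fun x =>
            s * (evalEval x (b x) (derivX v) * evalEval x (b x) (derivative v))) x₁ := by
          refine continuousAt_const.mul (ContinuousAt.mul ?_ ?_)
          · exact (continuous_evalEval (derivX v)).continuousAt.comp hcb
          · exact (continuous_evalEval (derivative v)).continuousAt.comp hcb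
        have hs0 : s ≠ 0 := by
          rintro rfl
          simp at hs
        have h8 : s * (evalEval x₁ y₁ (derivX v) * evalEval x₁ y₁ (derivative v)) < 0 :=
          hs₁.lt_of_ne (mul_ne_zero hs0 (mul_ne_zero (h x₁ y₁ hx₁0 (hx₁δ.trans hδδ₃) hv₁) hvy))
        exact (hc2.eventually_lt_const (by simpa only [hb] using h8)).mono fun _ => le_of_lt
    filter_upwards [hbv, e1, e2, Iio_mem_nhds hx₁δ] with x hx1 hx2 hx3 hx4 hx5
    have hx0 : 0 < x := hx₀.trans_le hx5
    refine ⟨⟨⟨hx5, hx4.le⟩, hx1⟩, ?_, hx3⟩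
    have hFx := hFne x (b x) hx0 (hx4.trans hδδ₁) hx1
    have := hwlt x (b x) hx0 hx4 hx1 hx2
    rwa [div_le_iff₀ (by positivity)] at this
  have hslope := (hasDerivAt_iff_tendsto_slope.1 hd2).eventually_lt_const hneg
  have hslope' := hslope.filter_mono (nhdsWithin_mono x₁ (fun x (hx : x ∈ Ioi x₁) => hx.ne'))
  obtain ⟨x, ⟨hx1, hx2⟩, hx3⟩ := ((hslope'.and (hev.filter_mono nhdsWithin_le_nhds)).and
    self_mem_nhdsWithin).exists
  rw [slope_def_field, div_neg_iff] at hx1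
  have := isMinOn_iff.1 hmin _ (hx2 (hx₁.trans hx3.le))
  simp only [Pi.sub_apply, Pi.add_apply, id_eq, hb] at hx1
  dsimp only at this
  rcases hx1 with h | h <;> linarith [h.1, h.2]

lemma exists_gradient_bound_on_curve {v F : ℝ[X][Y]} (hm : v.Monic) (hv : Prime v)
    (hvD : TotalDegLE v v.natDegree) {d : ℕ} (hF : TotalDegLE F d) {θ : ℝ} (hθ : 0 < θ)
    (hθ1 : θ < 1)
    (hθN : 2 * (1 - θ) * (v.natDegree * d * (v.natDegree + 1) : ℕ) ≤ 1) :
    ∃ c > 0, ∃ η > 0, ∃ δ > 0, ∀ x y : ℝ, 0 < x → x < δ → evalEval x y v = 0 →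
      |evalEval x y F| < η → c * |evalEval x y F| ^ (2 * θ) ≤ evalEval x y (gradSq F) := by
  have hzero : ∀ x y : ℝ, evalEval x y F = 0 →
      1 * |evalEval x y F| ^ (2 * θ) ≤ evalEval x y (gradSq F) := by
    intro x y h
    rw [h, abs_zero, Real.zero_rpow (by positivity), mul_zero, evalEval_gradSq]
    positivity
  by_cases hvF : v ∣ F
  · exact ⟨1, one_pos, 1, one_pos, 1, one_pos, fun x y _ _ h _ =>
      hzero x y (evalEval_eq_zero_of_dvd hvF h)⟩
  obtain ⟨η, hη, δ₁, hδ₁, h₁⟩ := exists_gradSq_ratio_large hm hv hvD hF hvF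
  obtain ⟨c, hc, δ₂, hδ₂, h₂⟩ := exists_lower_bound_on_curve hm hvD hv hF hvF
  set e := v.natDegree
  set α := 2 * (1 - θ) with hα
  have hα0 : 0 ≤ α := by linarith
  refine ⟨c ^ α, by positivity, η, hη, min (min δ₁ δ₂) 1, by positivity,
    fun x y hx hxδ hxy hFη => ?_⟩
  simp only [lt_min_iff] at hxδ
  have hlarge := h₁ x y hx hxδ.1.1 hxy hFη
  have hlow := h₂ x y hx hxδ.1.2 hxy
  have hpos : 0 < |evalEval x y F| := lt_of_lt_of_le (by positivity) hlow
  set t := |evalEval x y F| with ht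
  set B := evalEval x y (gradSq F) with hB
  have hB0 : 0 ≤ B := by
    rw [hB, evalEval_gradSq]
    positivity
  have ht2 : evalEval x y F ^ 2 = t ^ 2 := (sq_abs _).symm
  rw [ht2] at hlarge
  have hw0 : 0 ≤ B / t ^ 2 := by positivity
  have key : c ^ α ≤ t ^ α * (B / t ^ 2) := by
    refine le_of_pow_le_pow_left₀ (n := e + 1) (by omega) (by positivity) ?_
    calc (c ^ α) ^ (e + 1) ≤ (c ^ α) ^ (e + 1) * (x * (B / t ^ 2) ^ (e + 1)) :=
          le_mul_of_one_le_right (by positivity) hlarge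
      _ ≤ (c ^ α) ^ (e + 1) * (((x ^ (e * d)) ^ α) ^ (e + 1) * (B / t ^ 2) ^ (e + 1)) := by
          gcongr
          rw [← Real.rpow_natCast (n := e * d), ← Real.rpow_natCast (n := e + 1),
            ← Real.rpow_mul hx.le, ← Real.rpow_mul hx.le]
          conv_lhs => rw [← Real.rpow_one x]
          refine Real.rpow_le_rpow_of_exponent_ge hx hxδ.2.le ?_
          push_cast at hθN ⊢
          linarith
      _ = ((c * x ^ (e * d)) ^ α * (B / t ^ 2)) ^ (e + 1) := by
          rw [Real.mul_rpow hc.le (by positivity)]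
          ring
      _ ≤ (t ^ α * (B / t ^ 2)) ^ (e + 1) := by gcongr
  calc c ^ α * t ^ (2 * θ) ≤ t ^ α * (B / t ^ 2) * t ^ (2 * θ) := by gcongr
    _ = (t ^ α * t ^ (2 * θ)) / t ^ 2 * B := by ring
    _ = B := by
      have h2 : α + 2 * θ = (2 : ℕ) := by
        rw [hα]
        push_cast
        ring
      rw [← Real.rpow_add hpos, h2, Real.rpow_natCast, div_self (by positivity), one_mul]

/-- The numerator of the logarithmic `Y`-derivative of `F ^ (2 * θ) / gradSq F`. -/
noncomputable def fibreCritical (F : ℝ[X][Y]) (θ : ℝ) : ℝ[X][Y] :=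
  C (C (2 * θ)) * derivative F * gradSq F - F * derivative (gradSq F)

lemma TotalDegLE.gradSq {F : ℝ[X][Y]} {n : ℕ} (hF : TotalDegLE F (n + 1 : ℕ)) :
    TotalDegLE (gradSq F) (2 * n : ℕ) := by
  have h1 : TotalDegLE (_root_.derivX F) n := by simpa using hF.derivX
  have h2 : TotalDegLE (Polynomial.derivative F) n := by simpa using hF.derivative
  have h3 : TotalDegLE (_root_.derivX F ^ 2) (n + n) := by
    rw [pow_two]
    exact h1.mul h1
  have h4 : TotalDegLE (Polynomial.derivative F ^ 2) (n + n) := by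
    rw [pow_two]
    exact h2.mul h2
  exact (h3.add h4).mono (by push_cast; omega)

lemma TotalDegLE.fibreCritical {F : ℝ[X][Y]} {n : ℕ} (hF : TotalDegLE F (n + 1 : ℕ)) (θ : ℝ) :
    TotalDegLE (fibreCritical F θ) (3 * n : ℕ) := by
  have h2 : TotalDegLE (Polynomial.derivative F) n := by simpa using hF.derivative
  refine TotalDegLE.sub ?_ ?_
  · exact (((TotalDegLE.real _).mul h2).mul hF.gradSq).mono (by push_cast; omega)
  · exact (hF.mul hF.gradSq.derivative).mono (by push_cast; omega)

lemma coeff_fibreCritical {F : ℝ[X][Y]} {n : ℕ} (hF : TotalDegLE F (n + 1 : ℕ)) {a : ℝ}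
    (ha : a ≠ 0) (hFa : F.coeff (n + 1) = C a) (θ : ℝ) : ∃ L : ℝ, 0 < L ∧
      (fibreCritical F θ).coeff (3 * n) = C (2 * a * L * (θ * (n + 1) - n)) := by
  have h1 : TotalDegLE (derivX F) n := by simpa using hF.derivX
  have h2 : TotalDegLE (derivative F) n := by simpa using hF.derivative
  have hco : (derivative F).coeff n = C (a * (n + 1)) := by
    rw [coeff_derivative, hFa]
    simp
  obtain ⟨b, hb⟩ : ∃ b, (derivX F).coeff n = C b := by
    refine ⟨_, eq_C_of_natDegree_le_zero (DegLE.natDegree_le (k := 0) ?_)⟩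
    simpa using h1 n
  have hB : (gradSq F).coeff (2 * n) = C (b ^ 2 + (a * (n + 1)) ^ 2) := by
    rw [gradSq, coeff_add, pow_two, pow_two, two_mul,
      coeff_mul_add_eq_of_natDegree_le h1.natDegree_le h1.natDegree_le,
      coeff_mul_add_eq_of_natDegree_le h2.natDegree_le h2.natDegree_le, hb, hco, ← C_mul, ← C_mul,
      ← C_add]
    ring_nf
  refine ⟨b ^ 2 + (a * (n + 1)) ^ 2, by positivity, ?_⟩
  set L := b ^ 2 + (a * (n + 1)) ^ 2
  have e1 : (C (C (2 * θ)) * derivative F * gradSq F).coeff (3 * n) =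
      C (2 * θ * (a * (n + 1)) * L) := by
    rw [mul_assoc, coeff_C_mul, show 3 * n = n + 2 * n by ring,
      coeff_mul_add_eq_of_natDegree_le h2.natDegree_le hF.gradSq.natDegree_le, hB, hco, ← C_mul,
      ← C_mul]
    ring_nf
  have e2 : (F * derivative (gradSq F)).coeff (3 * n) = C (2 * n * a * L) := by
    rcases n with _ | k
    · have : derivative (gradSq F) = 0 :=
        derivative_of_natDegree_zero (Nat.le_zero.1 hF.gradSq.natDegree_le)
      simp [this]
    · have hd := hF.gradSq.derivative
      have hd' : (derivative (gradSq F)).natDegree ≤ 2 * k + 1 :=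
        TotalDegLE.natDegree_le (hd.mono (by push_cast; omega))
      rw [show 3 * (k + 1) = (k + 1 + 1) + (2 * k + 1) by ring,
        coeff_mul_add_eq_of_natDegree_le hF.natDegree_le hd', coeff_derivative,
        show 2 * k + 1 + 1 = 2 * (k + 1) by ring, hB, hFa]
      push_cast
      simp only [map_mul, map_add, map_natCast, map_one, map_ofNat]
      ring
  rw [fibreCritical, coeff_sub, e1, e2, ← C_sub]
  congr 1
  ring

lemma exists_gradient_bound_on_fibreCritical {F : ℝ[X][Y]} {n : ℕ}
    (hF : TotalDegLE F (n + 1 : ℕ)) {a : ℝ} (ha : a ≠ 0) (hFa : F.coeff (n + 1) = C a) {θ : ℝ}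
    (hθ : 1 - θ = 1 / (36 * (n + 1) ^ 3)) :
    ∃ c > 0, ∃ η > 0, ∃ δ > 0, ∀ x y : ℝ, 0 < x → x < δ → evalEval x y (fibreCritical F θ) = 0 →
      |evalEval x y F| < η → c * |evalEval x y F| ^ (2 * θ) ≤ evalEval x y (gradSq F) := by
  have hn : (0 : ℝ) < n + 1 := by positivity
  have h36 : (1 - θ) * (36 * (n + 1) ^ 3) = 1 := by
    rw [hθ]
    field_simp
  have hθ1 : 0 < 1 - θ := by
    rw [hθ]
    positivity
  have hbig : (1 - θ) * (n + 1) ≤ 1 / 36 := by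
    have h1 : (1 : ℝ) ≤ (n + 1) ^ 2 := one_le_pow₀ (by linarith)
    have h2 : (1 - θ) * (n + 1) * 1 ≤ (1 - θ) * (n + 1) * (n + 1) ^ 2 := by gcongr
    nlinarith
  have hθ0 : 0 < θ := by nlinarith
  obtain ⟨L, hL, hco⟩ := coeff_fibreCritical hF ha hFa θ
  have hne : 2 * a * L * (θ * (n + 1) - n) ≠ 0 := by
    have : 0 < θ * (n + 1) - n := by linarith
    positivity
  have hD := hF.fibreCritical θ
  have hdeg := hD.natDegree_eq (by rw [hco]; exact C_ne_zero.2 hne)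
  have := curve_induction (W := fibreCritical F θ) hne (by rw [leadingCoeff, hdeg, hco])
    (by rwa [hdeg]) (Q := fun S => ∃ c > 0, ∃ η > 0, ∃ δ > 0, ∀ z ∈ S, 0 < z.1 → z.1 < δ →
      |evalEval z.1 z.2 F| < η →
        c * |evalEval z.1 z.2 F| ^ (2 * θ) ≤ evalEval z.1 z.2 (gradSq F))
    ⟨1, one_pos, 1, one_pos, 1, one_pos, by simp⟩ ?_ ?_
  · obtain ⟨c, hc, η, hη, δ, hδ, h⟩ := this
    exact ⟨c, hc, η, hη, δ, hδ, fun x y hx hxδ hxy => h (x, y) hxy hx hxδ⟩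
  · rintro S T ⟨c, hc, η, hη, δ, hδ, h⟩ ⟨c', hc', η', hη', δ', hδ', h'⟩
    refine ⟨min c c', by positivity, min η η', by positivity, min δ δ', by positivity,
      fun z hz hz0 hzδ hzη => ?_⟩
    rw [lt_min_iff] at hzδ hzη
    rcases hz with hz | hz
    · refine le_trans ?_ (h z hz hz0 hzδ.1 hzη.1)
      gcongr
      exact min_le_left _ _
    · refine le_trans ?_ (h' z hz hz0 hzδ.2 hzη.2)
      gcongr
      exact min_le_right _ _
  · intro v hm hv hvD hdvd
    have hve : v.natDegree ≤ 3 * n := by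
      rw [← hdeg]
      refine natDegree_le_of_dvd hdvd fun h0 => hne ?_
      rw [h0, coeff_zero, eq_comm, C_eq_zero] at hco
      exact hco
    obtain ⟨c, hc, η, hη, δ, hδ, h⟩ := exists_gradient_bound_on_curve hm hv hvD hF hθ0
      (by linarith) (by
        have h3 : v.natDegree * (n + 1) * (v.natDegree + 1) ≤ 18 * (n + 1) ^ 3 := by
          calc _ ≤ (3 * (n + 1)) * (n + 1) * (3 * (n + 1)) := by gcongr <;> omega
            _ ≤ _ := by nlinarith [Nat.zero_le ((n + 1) ^ 3)]
        have h4 : ((v.natDegree * (n + 1) * (v.natDegree + 1) : ℕ) : ℝ) ≤ 18 * (n + 1) ^ 3 := by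
          exact_mod_cast h3
        calc _ ≤ 2 * (1 - θ) * (18 * (n + 1) ^ 3) := by gcongr
          _ = 1 := by linarith)
    exact ⟨c, hc, η, hη, δ, hδ, fun z hz hz0 hzδ hzη => h z.1 z.2 hz0 hzδ hz hzη⟩

lemma eventually_rpow_le_derivative_sq {p : ℝ[X]} (hp : p ≠ 0) {θ y₀ ε : ℝ} (hθ : 0 < θ)
    (hθN : (1 - θ) * p.natDegree < 1) (hy₀ : p.eval y₀ = 0) (hε : 0 < ε) :
    ∀ᶠ y in 𝓝 y₀, |p.eval y| ^ (2 * θ) ≤ ε * (derivative p).eval y ^ 2 := by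
  obtain ⟨q, hq, hq0⟩ := exists_eq_pow_rootMultiplicity_mul_and_not_dvd p hp y₀
  have hk := (rootMultiplicity_pos hp).2 hy₀
  set k := p.rootMultiplicity y₀
  have hkN : k ≤ p.natDegree := by
    have := natDegree_le_of_dvd ⟨q, hq⟩ hp
    rwa [natDegree_pow, natDegree_X_sub_C, mul_one] at this
  obtain ⟨j, hj⟩ : ∃ j, k = j + 1 := ⟨k - 1, by omega⟩
  rw [hj] at hq hkN
  rw [dvd_iff_isRoot, IsRoot] at hq0
  set β : ℝ := 2 * θ * (j + 1) - 2 * j with hβ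
  have hβ0 : 0 < β := by
    have hkN' : (j + 1 : ℝ) ≤ p.natDegree := by exact_mod_cast hkN
    rcases le_or_gt θ 1 with h | h
    · have : (1 - θ) * (j + 1) ≤ (1 - θ) * p.natDegree := by
        gcongr
      linarith
    · have : 0 ≤ (θ - 1) * (j + 1) := mul_nonneg (by linarith) (by positivity)
      linarith
  have h1 : Tendsto (fun y => |y - y₀| ^ β * |q.eval y| ^ (2 * θ)) (𝓝 y₀) (𝓝 0) := by
    have hc : Continuous fun y => |y - y₀| ^ β * |q.eval y| ^ (2 * θ) :=
      ((continuous_id.sub continuous_const).abs.rpow_const fun _ => .inr hβ0.le).mul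
        (q.continuous.abs.rpow_const fun _ => .inr (by positivity))
    have := hc.tendsto y₀
    simpa [Real.zero_rpow hβ0.ne'] using this
  have h2 : Tendsto (fun y => ε * (((j : ℝ) + 1) * q.eval y + (y - y₀) * (derivative q).eval y) ^ 2)
      (𝓝 y₀) (𝓝 (ε * (((j : ℝ) + 1) * q.eval y₀) ^ 2)) := by
    have hc : Continuous fun y =>
        ε * (((j : ℝ) + 1) * q.eval y + (y - y₀) * (derivative q).eval y) ^ 2 := by fun_prop
    have := hc.tendsto y₀
    simpa using this
  have hpos : 0 < ε * (((j : ℝ) + 1) * q.eval y₀) ^ 2 := by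
    have : 0 < (j : ℝ) + 1 := by positivity
    positivity
  filter_upwards [h1.eventually_lt h2 hpos] with y hy
  have hpy : p.eval y = (y - y₀) ^ (j + 1) * q.eval y := by
    rw [hq]
    simp
  have hdp : (derivative p).eval y =
      (y - y₀) ^ j * (((j : ℝ) + 1) * q.eval y + (y - y₀) * (derivative q).eval y) := by
    rw [hq]
    simp [derivative_mul, derivative_pow]
    ring
  rcases eq_or_ne y y₀ with rfl | hne
  · rw [hy₀, abs_zero, Real.zero_rpow (by positivity)]
    positivity
  have ht : 0 < |y - y₀| := abs_pos.2 (sub_ne_zero.2 hne)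
  have e : |p.eval y| ^ (2 * θ) = |y - y₀| ^ (2 * j) * (|y - y₀| ^ β * |q.eval y| ^ (2 * θ)) := by
    rw [hpy, abs_mul, abs_pow, Real.mul_rpow (by positivity) (by positivity),
      ← Real.rpow_natCast _ (j + 1), ← Real.rpow_natCast _ (2 * j), ← Real.rpow_mul ht.le,
      ← mul_assoc (_ ^ _) (_ ^ β), ← Real.rpow_add ht]
    congr 2
    rw [hβ]
    push_cast
    ring
  rw [e, hdp]
  calc _ ≤ |y - y₀| ^ (2 * j) *
        (ε * (((j : ℝ) + 1) * q.eval y + (y - y₀) * (derivative q).eval y) ^ 2) := by gcongr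
    _ = _ := by
      rw [(even_two_mul j).pow_abs]
      ring

lemma gradient_bound_on_fibre {F : ℝ[X][Y]} {θ x r c : ℝ} (hr : 0 < r) (hc : 0 < c) (hθ : 0 < θ)
    {p : ℝ[X]} (hp : p ≠ 0) (hpF : ∀ y, p.eval y = evalEval x y F)
    (hθN : (1 - θ) * p.natDegree < 1)
    (hcrit : ∀ y ∈ Icc (-r) r, evalEval x y (fibreCritical F θ) = 0 →
      c * |evalEval x y F| ^ (2 * θ) ≤ evalEval x y (gradSq F))
    (hend : ∀ y, |y| = r → c * |evalEval x y F| ^ (2 * θ) ≤ evalEval x y (gradSq F)) :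
    ∀ y ∈ Icc (-r) r, c * |evalEval x y F| ^ (2 * θ) ≤ evalEval x y (gradSq F) := by
  have hdF : ∀ y, (derivative p).eval y = evalEval x y (derivative F) := by
    intro y
    refine (p.hasDerivAt y).unique ?_
    exact (hasDerivAt_evalEval_snd F x y).congr_of_eventuallyEq (.of_forall hpF)
  have hB0 : ∀ y, 0 ≤ evalEval x y (gradSq F) := by
    intro y
    rw [evalEval_gradSq]
    positivity
  have hW : ∀ y, evalEval x y (fibreCritical F θ) =
      2 * θ * evalEval x y (derivative F) * evalEval x y (gradSq F) -
        evalEval x y F * evalEval x y (derivative (gradSq F)) := by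
    intro y
    simp [fibreCritical]
  have hBpos : ∀ y ∈ Icc (-r) r, evalEval x y F ≠ 0 → 0 < evalEval x y (gradSq F) := by
    intro y hy hFy
    refine (hB0 y).lt_of_ne fun h0 => ?_
    have h1 : evalEval x y (derivative (gradSq F)) = 0 := by
      refine IsLocalMin.hasDerivAt_eq_zero ?_ (hasDerivAt_evalEval_snd (gradSq F) x y)
      exact .of_forall fun z => by simpa only [← h0] using hB0 z
    have h2 := hcrit y hy (by rw [hW, ← h0, h1]; ring)
    rw [← h0] at h2
    have : 0 < c * |evalEval x y F| ^ (2 * θ) := by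
      have := abs_pos.2 hFy
      positivity
    linarith
  set R : ℝ → ℝ := fun y => |evalEval x y F| ^ (2 * θ) / evalEval x y (gradSq F) with hR
  have hFc : Continuous fun y => evalEval x y F :=
    (continuous_evalEval F).comp (continuous_const.prodMk continuous_id)
  have hBc : Continuous fun y => evalEval x y (gradSq F) :=
    (continuous_evalEval (gradSq F)).comp (continuous_const.prodMk continuous_id)
  have hR0 : ∀ y, 0 ≤ R y := fun y => div_nonneg (by positivity) (hB0 y)
  have hzero : ∀ y, evalEval x y F = 0 → R y = 0 := by
    intro y hy
    simp only [hR]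
    rw [hy, abs_zero, Real.zero_rpow (by positivity), zero_div]
  have hRc : ContinuousOn R (Icc (-r) r) := by
    intro y hy
    refine ContinuousAt.continuousWithinAt ?_
    by_cases hFy : evalEval x y F = 0
    · rw [ContinuousAt, hzero y hFy]
      refine tendsto_order.2 ⟨fun a ha => .of_forall fun z => ha.trans_le (hR0 z),
        fun a ha => ?_⟩
      filter_upwards [eventually_rpow_le_derivative_sq hp hθ hθN ((hpF y).trans hFy)
        (half_pos ha)] with z hz
      refine lt_of_le_of_lt ?_ (half_lt_self ha)
      refine div_le_of_le_mul₀ (hB0 z) (by positivity) ?_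
      rw [← hpF]
      refine hz.trans ?_
      gcongr
      rw [evalEval_gradSq, hdF]
      nlinarith [sq_nonneg (evalEval x z (derivX F))]
    · exact (hFc.continuousAt.abs.rpow_const (.inr (by positivity))).div hBc.continuousAt
        (hBpos y hy hFy).ne'
  obtain ⟨y₁, hy₁, hmax⟩ := isCompact_Icc.exists_isMaxOn (nonempty_Icc.2 (by linarith)) hRc
  have hR₁ : R y₁ ≤ 1 / c := by
    by_cases hF₁ : evalEval x y₁ F = 0
    · rw [hzero _ hF₁]
      positivity
    have hB₁ := hBpos y₁ hy₁ hF₁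
    have hconv : c * |evalEval x y₁ F| ^ (2 * θ) ≤ evalEval x y₁ (gradSq F) → R y₁ ≤ 1 / c := by
      intro h
      rw [hR, div_le_div_iff₀ hB₁ hc]
      linarith
    refine hconv ?_
    by_cases hb : |y₁| = r
    · exact hend y₁ hb
    refine hcrit y₁ hy₁ ?_
    have hlt := (abs_le.2 hy₁).lt_of_ne hb
    rw [abs_lt] at hlt
    have hder := (((hasDerivAt_evalEval_snd F x y₁).log hF₁).const_mul (2 * θ)).sub
      ((hasDerivAt_evalEval_snd (gradSq F) x y₁).log hB₁.ne')
    have hloc : IsLocalMax ((fun y => 2 * θ * Real.log (evalEval x y F)) -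
        fun y => Real.log (evalEval x y (gradSq F))) y₁ := by
      have hlogR : ∀ y ∈ Icc (-r) r, evalEval x y F ≠ 0 → Real.log (R y) =
          2 * θ * Real.log (evalEval x y F) - Real.log (evalEval x y (gradSq F)) := by
        intro y hy hFy
        have := abs_pos.2 hFy
        rw [hR, Real.log_div (by positivity) (hBpos y hy hFy).ne', Real.log_rpow this,
          Real.log_abs]
      filter_upwards [Ioo_mem_nhds hlt.1 hlt.2, hFc.continuousAt.eventually_ne hF₁] with y hy hFy
      have hy' := Ioo_subset_Icc_self hy
      simp only [Pi.sub_apply]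
      rw [← hlogR y hy' hFy, ← hlogR y₁ hy₁ hF₁]
      refine Real.log_le_log ?_ (isMaxOn_iff.1 hmax y hy')
      have := abs_pos.2 hFy
      have := hBpos y hy' hFy
      positivity
    have h0 := hloc.hasDerivAt_eq_zero hder
    rw [hW]
    field_simp at h0
    linarith
  intro y hy
  by_cases hFy : evalEval x y F = 0
  · rw [hFy, abs_zero, Real.zero_rpow (by positivity), mul_zero]
    exact hB0 y
  · have h1 := (isMaxOn_iff.1 hmax y hy).trans hR₁
    simp only [hR] at h1
    rw [div_le_div_iff₀ (hBpos y hy hFy) hc] at h1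
    linarith

lemma exists_gradient_bound_right {F : ℝ[X][Y]} {n : ℕ} (hF : TotalDegLE F (n + 1 : ℕ)) {a : ℝ}
    (ha : a ≠ 0) (hFa : F.coeff (n + 1) = C a) (hF0 : evalEval 0 0 F = 0) {θ : ℝ}
    (hθ : 1 - θ = 1 / (36 * (n + 1) ^ 3)) :
    ∃ c > 0, ∃ ε > 0, ∀ x y : ℝ, 0 < x → x < ε → |y| < ε →
      c * |evalEval x y F| ^ (2 * θ) ≤ evalEval x y (gradSq F) := by
  have hn : (0 : ℝ) < n + 1 := by positivity
  have hθ1 : 0 < 1 - θ := by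
    rw [hθ]
    positivity
  have hbig : (1 - θ) * (n + 1) < 1 := by
    have h1 : (1 : ℝ) ≤ (n + 1) ^ 2 := one_le_pow₀ (by linarith)
    rw [hθ, div_mul_eq_mul_div, div_lt_one (by positivity)]
    nlinarith
  have hθ0 : 0 < θ := by nlinarith
  obtain ⟨c, hc, η, hη, δ, hδ, h⟩ := exists_gradient_bound_on_fibreCritical hF ha hFa hθ
  have hco : (derivative F).coeff n = C (a * (n + 1)) := by
    rw [coeff_derivative, hFa]
    simp
  obtain ⟨ε, hε, hsmall⟩ : ∃ ε > 0, ∀ x y : ℝ, |x| < ε → |y| < ε →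
      |evalEval x y F| < min η 1 := by
    have hev : ∀ᶠ z : ℝ × ℝ in 𝓝 (0, 0), |evalEval z.1 z.2 F| < min η 1 := by
      refine (continuous_evalEval F).abs.continuousAt.eventually_lt_const ?_
      dsimp only
      rw [hF0, abs_zero]
      positivity
    obtain ⟨ε, hε, h'⟩ := Metric.eventually_nhds_iff.1 hev
    refine ⟨ε, hε, fun x y hx hy => h' (y := (x, y)) ?_⟩
    rw [Prod.dist_eq, Real.dist_eq, Real.dist_eq, sub_zero, sub_zero]
    exact max_lt hx hy
  obtain ⟨r, ⟨hr, hrε⟩, hr1, hr2⟩ : ∃ r ∈ Ioo 0 ε, evalEval 0 r (derivative F) ≠ 0 ∧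
      evalEval 0 (-r) (derivative F) ≠ 0 := by
    set q := (derivative F).map (evalRingHom 0) with hq
    have hq0 : q ≠ 0 := by
      intro h0
      have := congrArg (fun r => coeff r n) h0
      simp only [hq, coeff_map, hco, coeff_zero, coe_evalRingHom, eval_C] at this
      exact (mul_ne_zero ha hn.ne') this
    have hfin : {y : ℝ | q.eval y = 0 ∨ q.eval (-y) = 0}.Finite := by
      have hf : {y : ℝ | q.eval y = 0}.Finite := by
        refine q.roots.toFinset.finite_toSet.subset fun y hy => ?_
        simpa [hq0] using hy
      exact hf.union (hf.preimage neg_injective.injOn)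
    obtain ⟨r, hr, hr'⟩ := ((Ioo_infinite hε).sdiff hfin).nonempty
    refine ⟨r, hr, fun h0 => hr' (.inl ?_), fun h0 => hr' (.inr ?_)⟩
    · rw [hq, map_evalRingHom_eval, h0]
    · rw [hq, map_evalRingHom_eval, h0]
  have hend : ∀ s : ℝ, evalEval 0 s (derivative F) ≠ 0 → ∃ ρ > 0, ∃ δ > 0, ∀ x, |x| < δ →
      ρ ≤ evalEval x s (gradSq F) := by
    intro s hs
    have hcont : Continuous fun x => evalEval x s (gradSq F) :=
      (continuous_evalEval (gradSq F)).comp (continuous_id.prodMk continuous_const)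
    have hpos : 0 < evalEval 0 s (gradSq F) := by
      rw [evalEval_gradSq]
      positivity
    obtain ⟨δ, hδ, h'⟩ := Metric.eventually_nhds_iff.1
      (hcont.continuousAt.eventually_const_lt (half_lt_self hpos))
    refine ⟨_, half_pos hpos, δ, hδ, fun x hx => (h' (y := x) ?_).le⟩
    rwa [Real.dist_eq, sub_zero]
  obtain ⟨ρ₁, hρ₁, δ₁, hδ₁, hd₁⟩ := hend r hr1
  obtain ⟨ρ₂, hρ₂, δ₂, hδ₂, hd₂⟩ := hend (-r) hr2
  set κ := min c (min ρ₁ ρ₂)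
  have hκ : 0 < κ := by positivity
  refine ⟨κ, hκ, min (min (min δ δ₁) (min δ₂ ε)) r, by positivity, fun x y hx hxδ hy => ?_⟩
  simp only [lt_min_iff] at hxδ hy
  obtain ⟨⟨⟨hxδ, hxδ₁⟩, hxδ₂, hxε⟩, -⟩ := hxδ
  have hax : |x| = x := abs_of_pos hx
  have hsm : ∀ y ∈ Icc (-r) r, |evalEval x y F| < min η 1 := fun y hy =>
    hsmall x y (by rwa [hax]) ((abs_le.2 hy).trans_lt hrε)
  have hFd : F.natDegree = n + 1 := hF.natDegree_eq (by rw [hFa]; exact C_ne_zero.2 ha)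
  set p := F.map (evalRingHom x) with hp
  have hpco : p.coeff (n + 1) = a := by
    rw [hp, coeff_map, hFa]
    simp
  have hle1 : ∀ y ∈ Icc (-r) r, |evalEval x y F| ^ (2 * θ) ≤ 1 := fun y hy =>
    Real.rpow_le_one (abs_nonneg _) ((lt_min_iff.1 (hsm y hy)).2.le) (by positivity)
  have hrI : -r ≤ r := by linarith
  refine gradient_bound_on_fibre hr hκ hθ0 (p := p) (fun h0 => ha ?_)
    (fun y => by rw [hp, map_evalRingHom_eval]) ?_ ?_ ?_ y (abs_le.1 hy.2.le)
  · rw [← hpco, h0, coeff_zero]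
  · have : (p.natDegree : ℝ) ≤ n + 1 := by
      have : p.natDegree ≤ n + 1 := natDegree_map_le.trans hFd.le
      exact_mod_cast this
    refine lt_of_le_of_lt ?_ hbig
    gcongr
  · intro y hy hW
    refine le_trans ?_ (h x y hx hxδ hW ((lt_min_iff.1 (hsm y hy)).1))
    gcongr
    exact min_le_left _ _
  · intro y hy
    rcases eq_or_eq_neg_of_abs_eq hy with rfl | rfl
    · refine le_trans ?_ (hd₁ x (by rwa [hax]))
      refine (mul_le_of_le_one_right hκ.le (hle1 _ ⟨hrI, le_rfl⟩)).trans ?_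
      exact (min_le_right _ _).trans (min_le_left _ _)
    · refine le_trans ?_ (hd₂ x (by rwa [hax]))
      refine (mul_le_of_le_one_right hκ.le (hle1 _ ⟨le_rfl, hrI⟩)).trans ?_
      exact (min_le_right _ _).trans (min_le_right _ _)

lemma eval_smul_of_isHomogeneous {σ : Type*} {φ : MvPolynomial σ ℝ} {n : ℕ}
    (h : φ.IsHomogeneous n) (t : ℝ) (w : σ → ℝ) :
    MvPolynomial.eval (t • w) φ = t ^ n * MvPolynomial.eval w φ := by
  rw [MvPolynomial.eval_eq, MvPolynomial.eval_eq, Finset.mul_sum]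
  refine Finset.sum_congr rfl fun m hm => ?_
  have hmn : ∑ i ∈ m.support, m i = n := by
    rw [← h (MvPolynomial.mem_support_iff.1 hm), Finsupp.weight_apply, Finsupp.sum]
    simp
  simp only [Pi.smul_apply, smul_eq_mul, mul_pow, Finset.prod_mul_distrib,
    Finset.prod_pow_eq_pow_sum, hmn]
  ring

lemma eval_smul_eq_sum {σ : Type*} (f : MvPolynomial σ ℝ) (t : ℝ) (w : σ → ℝ) :
    MvPolynomial.eval (t • w) f = ∑ j ∈ Finset.range (f.totalDegree + 1),
      t ^ j * MvPolynomial.eval w (f.homogeneousComponent j) := by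
  conv_lhs => rw [← f.sum_homogeneousComponent, map_sum]
  exact Finset.sum_congr rfl fun j _ =>
    eval_smul_of_isHomogeneous (f.homogeneousComponent_isHomogeneous j) t w

lemma exists_lower_bound_on_cone {σ : Type*} [Fintype σ] (f : MvPolynomial σ ℝ) {k : ℕ}
    (hk : ∀ j < k, f.homogeneousComponent j = 0) {b : σ → ℝ}
    (hb : MvPolynomial.eval b (f.homogeneousComponent k) ≠ 0) :
    ∃ c > 0, ∃ ε > 0, ∀ w : σ → ℝ, ‖w - b‖ < ε → ∀ y : ℝ, |y| < ε →
      c * |y| ^ k ≤ |MvPolynomial.eval (y • w) f| := by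
  set H : (σ → ℝ) × ℝ → ℝ := fun z => ∑ j ∈ Finset.range (f.totalDegree + 1),
    z.2 ^ (j - k) * MvPolynomial.eval z.1 (f.homogeneousComponent j)
  have hHc : Continuous H := by
    refine continuous_finsetSum _ fun j _ => (continuous_snd.pow _).mul ?_
    exact (MvPolynomial.continuous_eval _).comp continuous_fst
  have hkd : k ∈ Finset.range (f.totalDegree + 1) := by
    rw [Finset.mem_range, Nat.lt_succ_iff]
    by_contra hlt
    rw [f.homogeneousComponent_eq_zero _ (not_le.1 hlt), map_zero] at hb
    exact hb rfl
  have hH0 : H (b, 0) = MvPolynomial.eval b (f.homogeneousComponent k) := by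
    simp only [H]
    rw [Finset.sum_eq_single_of_mem k hkd, Nat.sub_self, pow_zero, one_mul]
    intro j _ hjk
    rcases lt_or_gt_of_ne hjk with h | h
    · rw [hk j h, map_zero, mul_zero]
    · rw [zero_pow (by omega), zero_mul]
  have hpos : 0 < |H (b, 0)| := by
    rw [hH0]
    exact abs_pos.2 hb
  obtain ⟨ε, hε, h⟩ := Metric.eventually_nhds_iff.1
    (hHc.abs.continuousAt.eventually_const_lt (half_lt_self hpos))
  refine ⟨_, half_pos hpos, ε, hε, fun w hw y hy => ?_⟩
  have h1 := h (y := (w, y)) (by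
    rw [Prod.dist_eq, dist_eq_norm, dist_eq_norm, sub_zero]
    exact max_lt hw hy)
  have e : MvPolynomial.eval (y • w) f = y ^ k * H (w, y) := by
    rw [eval_smul_eq_sum, Finset.mul_sum]
    refine Finset.sum_congr rfl fun j _ => ?_
    rcases lt_or_ge j k with h | h
    · rw [hk j h, map_zero, mul_zero, mul_zero, mul_zero]
    · rw [← mul_assoc, ← pow_add, Nat.add_sub_cancel' h]
  rw [e, abs_mul, abs_pow, mul_comm]
  gcongr

/-- The polynomial `f (X • a + Y • b)` in the two variables `X`, `Y`. -/
noncomputable def planeRestrict {σ : Type*} (f : MvPolynomial σ ℝ) (a b : σ → ℝ) : ℝ[X][Y] :=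
  MvPolynomial.aeval (fun i => C (C (a i) * X) + C (C (b i)) * X) f

lemma evalEval_planeRestrict {σ : Type*} (f : MvPolynomial σ ℝ) (a b : σ → ℝ) (x y : ℝ) :
    evalEval x y (planeRestrict f a b) = MvPolynomial.eval (x • a + y • b) f := by
  unfold planeRestrict
  induction f using MvPolynomial.induction_on with
  | C c => simp [Polynomial.algebraMap_apply]
  | add p q hp hq => rw [map_add, evalEval_add, hp, hq, map_add]
  | mul_X p i hp =>
    rw [map_mul, evalEval_mul, hp, map_mul]
    simp [evalEval_C]
    ring_nf
    simp

lemma totalDegLE_planeRestrict {σ : Type*} (f : MvPolynomial σ ℝ) (a b : σ → ℝ) :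
    TotalDegLE (planeRestrict f a b) f.totalDegree := by
  have hlin : ∀ i, TotalDegLE (C (C (a i) * X) + C (C (b i)) * X : ℝ[X][Y]) 1 := by
    intro i
    refine .add (.const fun m hm => ?_) ?_
    · rw [coeff_C_mul_X, if_neg (by omega)]
    · simpa using (TotalDegLE.real (b i)).mul (.X_pow 1)
  have hpow : ∀ (q : ℝ[X][Y]), TotalDegLE q 1 → ∀ m : ℕ, TotalDegLE (q ^ m) m := by
    intro q hq m
    induction m with
    | zero => simpa using TotalDegLE.X_pow 0
    | succ m ih =>
      rw [pow_succ]
      exact (ih.mul hq).mono (by push_cast; omega)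
  have hprod : ∀ (s : Finset σ) (m : σ → ℕ), TotalDegLE
      (∏ i ∈ s, (C (C (a i) * X) + C (C (b i)) * X : ℝ[X][Y]) ^ m i) (∑ i ∈ s, m i : ℕ) := by
    classical
    intro s m
    induction s using Finset.induction_on with
    | empty => simpa using TotalDegLE.X_pow 0
    | insert i s hi ih =>
      rw [Finset.prod_insert hi, Finset.sum_insert hi]
      exact ((hpow _ (hlin i) (m i)).mul ih).mono (by push_cast; omega)
  rw [planeRestrict, MvPolynomial.aeval_def, MvPolynomial.eval₂_eq]
  refine .sum fun m hm => ?_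
  have h1 := (TotalDegLE.real (f.coeff m)).mul (hprod m.support m)
  refine TotalDegLE.mono (n := 0 + (∑ i ∈ m.support, m i : ℕ)) h1 ?_
  have := MvPolynomial.le_totalDegree hm
  rw [Finsupp.sum] at this
  omega

lemma coeff_planeRestrict {σ : Type*} (f : MvPolynomial σ ℝ) (a b : σ → ℝ) {d : ℕ}
    (hd : f.totalDegree = d) :
    (planeRestrict f a b).coeff d = C (MvPolynomial.eval b (f.homogeneousComponent d)) := by
  set F := planeRestrict f a b with hF
  have h1 : F.coeff d = C ((F.coeff d).coeff 0) := by
    refine eq_C_of_natDegree_eq_zero (Nat.le_zero.1 (DegLE.natDegree_le ?_))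
    have := totalDegLE_planeRestrict f a b d
    rwa [hd, sub_self] at this
  have h2 : F.map (evalRingHom 0) = ∑ j ∈ Finset.range (d + 1),
      C (MvPolynomial.eval b (f.homogeneousComponent j)) * X ^ j := by
    refine Polynomial.funext fun t => ?_
    rw [map_evalRingHom_eval, hF, evalEval_planeRestrict, zero_smul, zero_add, eval_smul_eq_sum,
      eval_finsetSum, hd]
    exact Finset.sum_congr rfl fun j _ => by rw [eval_C_mul, eval_X_pow, mul_comm]
  have h3 := congrArg (fun p => p.coeff d) h2
  simp only [coeff_map, finsetSum_coeff, coeff_C_mul_X_pow] at h3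
  rw [Finset.sum_ite_eq, if_pos (Finset.self_mem_range_succ d), h1] at h3
  simp only [coe_evalRingHom, eval_C] at h3
  rw [h1, h3]

lemma exists_good_direction {f : MvPolynomial (Fin 2) ℝ} {d : ℕ} (hd : 1 ≤ d)
    (hdeg : f.totalDegree = d) : ∃ k ≤ d, (∀ j < k, f.homogeneousComponent j = 0) ∧
      ∃ u v : ℝ, u ^ 2 + v ^ 2 = 1 ∧ MvPolynomial.eval ![u, v] (f.homogeneousComponent d) ≠ 0 ∧
        MvPolynomial.eval ![u, v] (f.homogeneousComponent k) ≠ 0 := by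
  have hf : f ≠ 0 := by
    rintro rfl
    rw [MvPolynomial.totalDegree_zero] at hdeg
    omega
  have hd0 : f.homogeneousComponent d ≠ 0 := by
    obtain ⟨m, hm, hmd⟩ := Finset.exists_mem_eq_sup f.support
      (MvPolynomial.support_nonempty.2 hf) fun m => m.sum fun _ e => e
    rw [← MvPolynomial.totalDegree, hdeg] at hmd
    intro h0
    have := congrArg (MvPolynomial.coeff m) h0
    rw [MvPolynomial.coeff_homogeneousComponent, if_pos, MvPolynomial.coeff_zero] at this
    · exact MvPolynomial.mem_support_iff.1 hm this
    · exact hmd.symm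
  classical
  have hex : ∃ k, f.homogeneousComponent k ≠ 0 := ⟨d, hd0⟩
  set k := Nat.find hex
  have hk0 : f.homogeneousComponent k ≠ 0 := Nat.find_spec hex
  refine ⟨k, Nat.find_min' hex hd0, fun j hj => not_not.1 (Nat.find_min hex hj), ?_⟩
  obtain ⟨w, hw⟩ : ∃ w, MvPolynomial.eval w
      (f.homogeneousComponent d * f.homogeneousComponent k) ≠ 0 := by
    by_contra! h
    exact mul_ne_zero hd0 hk0 (MvPolynomial.funext fun w => by rw [h w, map_zero])
  rw [map_mul, mul_ne_zero_iff] at hw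
  have hwd := f.homogeneousComponent_isHomogeneous d
  have hwk := f.homogeneousComponent_isHomogeneous k
  have hpos : 0 < w 0 ^ 2 + w 1 ^ 2 := by
    by_contra hle
    have h0 : w 0 = 0 := by nlinarith [sq_nonneg (w 0), sq_nonneg (w 1)]
    have h1 : w 1 = 0 := by nlinarith [sq_nonneg (w 0), sq_nonneg (w 1)]
    have hw0 : w = (0 : ℝ) • w := by
      ext i
      fin_cases i <;> simp [h0, h1]
    apply hw.1
    rw [hw0, eval_smul_of_isHomogeneous hwd, zero_pow (by omega), zero_mul]
  set s := √(w 0 ^ 2 + w 1 ^ 2) with hs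
  have hs0 : 0 < s := Real.sqrt_pos.2 hpos
  have e : ![s⁻¹ * w 0, s⁻¹ * w 1] = s⁻¹ • w := by
    ext i
    fin_cases i <;> simp
  refine ⟨s⁻¹ * w 0, s⁻¹ * w 1, ?_, ?_, ?_⟩
  · have : s ^ 2 = w 0 ^ 2 + w 1 ^ 2 := Real.sq_sqrt hpos.le
    field_simp
    exact this.symm
  · rw [e, eval_smul_of_isHomogeneous hwd]
    exact mul_ne_zero (by positivity) hw.1
  · rw [e, eval_smul_of_isHomogeneous hwk]
    exact mul_ne_zero (by positivity) hw.2

lemma norm_le_of_forall_slope {E : Type*} [NormedAddCommGroup E] [NormedSpace ℝ E] {G : E → ℝ}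
    {G' : E →L[ℝ] ℝ} {m : E} {r : ℝ} (hr : 0 ≤ r) (hG : HasFDerivAt G G' m)
    (h : ∀ᶠ z in 𝓝 m, G m ≤ G z + r * ‖z - m‖) : ‖G'‖ ≤ r := by
  have hlow : ∀ v, -(r * ‖v‖) ≤ G' v := by
    intro v
    have hline : HasDerivAt (fun t : ℝ => m + t • v) v 0 := by
      simpa using ((hasDerivAt_id (0 : ℝ)).smul_const v).const_add m
    have hcomp : HasDerivAt (fun t : ℝ => G (m + t • v)) (G' v) 0 := by
      refine HasFDerivAt.comp_hasDerivAt 0 ?_ hline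
      simpa using hG
    refine ge_of_tendsto hcomp.tendsto_slope_zero_right ?_
    have hev : ∀ᶠ t : ℝ in 𝓝 0, G m ≤ G (m + t • v) + r * ‖m + t • v - m‖ := by
      refine hline.continuousAt.eventually (p := fun z => G m ≤ G z + r * ‖z - m‖) ?_
      simpa using h
    filter_upwards [hev.filter_mono nhdsWithin_le_nhds, self_mem_nhdsWithin] with t ht ht0
    have ht0 : 0 < t := ht0
    rw [add_sub_cancel_left, norm_smul, Real.norm_of_nonneg ht0.le] at ht
    rw [zero_add, zero_smul, add_zero, smul_eq_mul, ← div_eq_inv_mul, le_div_iff₀ ht0]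
    linarith
  refine G'.opNorm_le_bound hr fun v => ?_
  rw [Real.norm_eq_abs, abs_le]
  refine ⟨hlow v, ?_⟩
  have := hlow (-v)
  rw [map_neg, norm_neg] at this
  linarith

lemma exists_distance_bound_of_gradient_bound {E : Type*} [NormedAddCommGroup E]
    [NormedSpace ℝ E] [ProperSpace E] {g : E → ℝ} (hg : Differentiable ℝ g) (hg0 : g 0 = 0)
    {l c ε : ℝ} (hl : l < 1) (hc : 0 < c) (hε : 0 < ε)
    (h : ∀ z, ‖z‖ < ε → c * ‖g z‖ ^ l ≤ ‖fderiv ℝ g z‖) :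
    ∃ c > 0, ∃ ε > 0, ∀ z : E, ‖z‖ < ε →
      c * Metric.infDist z {w | g w = 0} ^ (1 / (1 - l)) ≤ |g z| := by
  have hl1 : 0 < 1 - l := by linarith
  set κ := c * (1 - l)
  have hκ : 0 < κ := by positivity
  have hGc : Continuous fun z => |g z| ^ (1 - l) :=
    hg.continuous.abs.rpow_const fun _ => .inr hl1.le
  obtain ⟨ε', hε', hsmall⟩ : ∃ ε' > 0, ∀ z, ‖z‖ < ε' → |g z| ^ (1 - l) < κ / 2 * (ε / 4) := by
    have hev : ∀ᶠ z in 𝓝 (0 : E), |g z| ^ (1 - l) < κ / 2 * (ε / 4) := by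
      refine hGc.continuousAt.eventually_lt_const ?_
      dsimp only
      rw [hg0, abs_zero, Real.zero_rpow hl1.ne']
      positivity
    obtain ⟨ε', hε', h'⟩ := Metric.eventually_nhds_iff.1 hev
    exact ⟨ε', hε', fun z hz => h' (by rwa [dist_zero_right])⟩
  refine ⟨(κ / 2) ^ (1 / (1 - l)), by positivity, min ε' (ε / 4), by positivity,
    fun z hz => ?_⟩
  rw [lt_min_iff] at hz
  obtain ⟨m, hmK, hm⟩ := (isCompact_closedBall (0 : E) (ε / 2)).exists_isMinOn
    (f := fun w => |g w| ^ (1 - l) + κ / 2 * ‖w - z‖) ⟨0, by simp; positivity⟩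
    (hGc.add (continuous_const.mul (continuous_id.sub continuous_const).norm)).continuousOn
  have hmz := isMinOn_iff.1 hm z (by rw [mem_closedBall_zero_iff]; linarith)
  simp only [sub_self, norm_zero, mul_zero, add_zero] at hmz
  have hnn : 0 ≤ |g m| ^ (1 - l) := by positivity
  have hdist : κ / 2 * ‖m - z‖ ≤ |g z| ^ (1 - l) := by linarith
  have hmε : ‖m‖ < ε / 2 := by
    have h1 : ‖m - z‖ < ε / 4 := by
      have := hdist.trans_lt (hsmall z hz.1)
      exact lt_of_mul_lt_mul_left this (by positivity)
    have := norm_le_norm_add_norm_sub' m z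
    linarith
  have hgm : g m = 0 := by
    by_contra hne
    have hpos := abs_pos.2 hne
    have hder := ((hg m).hasFDerivAt.abs hne).rpow_const (p := 1 - l) (.inl hpos.ne')
    have hle := norm_le_of_forall_slope (half_pos hκ).le hder (by
      filter_upwards [Metric.isOpen_ball.mem_nhds (mem_ball_zero_iff.2 hmε)] with w hw
      have h1 := isMinOn_iff.1 hm w (Metric.ball_subset_closedBall hw)
      have h2 := norm_sub_le_norm_sub_add_norm_sub w m z
      nlinarith)
    have hgrad := h m (by linarith)
    rw [norm_smul, norm_smul] at hle
    have hs : ‖((SignType.sign (g m) : SignType) : ℝ)‖ = 1 := by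
      rcases lt_or_gt_of_ne hne with h | h <;> simp [h]
    rw [hs, one_mul, show (1 - l - 1) = -l by ring, norm_mul, Real.norm_of_nonneg hl1.le,
      Real.norm_of_nonneg (by positivity)] at hle
    rw [Real.norm_eq_abs] at hgrad
    have : κ ≤ (1 - l) * |g m| ^ (-l) * ‖fderiv ℝ g m‖ := by
      calc κ = (1 - l) * |g m| ^ (-l) * (c * |g m| ^ l) := by
            rw [Real.rpow_neg hpos.le]
            field_simp
            exact mul_comm _ _
        _ ≤ _ := by gcongr
    linarith
  have hinf : κ / 2 * Metric.infDist z {w | g w = 0} ≤ |g z| ^ (1 - l) := by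
    refine le_trans ?_ hdist
    gcongr
    rw [← dist_eq_norm, dist_comm]
    exact Metric.infDist_le_dist_of_mem hgm
  rw [← Real.mul_rpow (by positivity) Metric.infDist_nonneg]
  calc _ ≤ (|g z| ^ (1 - l)) ^ (1 / (1 - l)) :=
        Real.rpow_le_rpow (mul_nonneg (by positivity) Metric.infDist_nonneg) hinf (by positivity)
    _ = |g z| := by rw [← Real.rpow_mul (abs_nonneg _), mul_one_div_cancel hl1.ne', Real.rpow_one]

lemma exists_distance_bound_off_cone {E : Type*} [NormedAddCommGroup E] [NormedSpace ℝ E]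
    {g : E → ℝ} (hg0 : g 0 = 0) {a b : E} (ha : ‖a‖ = 1) (hb : ‖b‖ = 1) {F : ℝ[X][Y]} {n : ℕ}
    (hF : TotalDegLE F (n + 1 : ℕ)) {α : ℝ} (hα : α ≠ 0) (hFα : F.coeff (n + 1) = C α)
    (hgF : ∀ x y : ℝ, g (x • a + y • b) = evalEval x y F) {s : ℝ} (hs : 0 < s) :
    ∃ c > 0, ∃ ε > 0, ∀ x y : ℝ, 0 < x → x < ε → s * |y| ≤ x → |y| < ε →
      c * Metric.infDist (x • a + y • b) {w | g w = 0} ^ (n ^ 2 + 1) ≤ |evalEval x y F| := by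
  obtain ⟨κ, hκ, h1⟩ := exists_nearby_critical_point (n + 1) n.succ_ne_zero hα
  obtain ⟨c, hc, δ, hδ, h2⟩ := exists_lower_bound_on_polar hF hα hFα
  refine ⟨min κ (c / (1 + 1 / s) ^ (n ^ 2 + 1)), by positivity, min δ (1 / 2), by positivity,
    fun x y hx hxδ hxy hy => ?_⟩
  rw [lt_min_iff] at hxδ hy
  set D := Metric.infDist (x • a + y • b) {w | g w = 0}
  have hD0 : 0 ≤ D := Metric.infDist_nonneg
  have hDz : D ≤ x + |y| := by
    refine (Metric.infDist_le_dist_of_mem (show (0 : E) ∈ {w | g w = 0} from hg0)).trans ?_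
    rw [dist_zero_right]
    refine (norm_add_le _ _).trans ?_
    rw [norm_smul, norm_smul, ha, hb, mul_one, mul_one, Real.norm_of_nonneg hx.le,
      Real.norm_eq_abs]
  set p := F.map (evalRingHom x) with hp
  have hpe : ∀ t, p.eval t = evalEval x t F := fun t => by rw [hp, map_evalRingHom_eval]
  have hFd : F.natDegree = n + 1 := hF.natDegree_eq (by rw [hFα]; exact C_ne_zero.2 hα)
  have hpco : p.coeff (n + 1) = α := by
    rw [hp, coeff_map, hFα]
    simp
  have hpd : p.natDegree = n + 1 := by
    refine le_antisymm (natDegree_map_le.trans hFd.le) (le_natDegree_of_ne_zero ?_)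
    rwa [hpco]
  obtain ⟨t, ht, htp, hyt⟩ := h1 p hpd (by rw [leadingCoeff, hpd, hpco]) y
  rw [hpe, hpe] at htp
  rw [hpe] at hyt
  have hzero : evalEval x t F = 0 → κ * D ^ (n ^ 2 + 1) ≤ |evalEval x y F| := by
    intro h0
    refine le_trans ?_ hyt
    have hDt : D ≤ |y - t| := by
      refine (Metric.infDist_le_dist_of_mem (y := x • a + t • b)
        (show g (x • a + t • b) = 0 by rw [hgF, h0])).trans ?_
      rw [dist_add_left, dist_eq_norm, ← sub_smul, norm_smul, hb, mul_one, Real.norm_eq_abs]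
    have hpow : D ^ (n ^ 2 + 1) ≤ D ^ (n + 1) :=
      pow_le_pow_of_le_one hD0 (by linarith) (by nlinarith [Nat.le_self_pow two_ne_zero n])
    calc _ ≤ κ * D ^ (n + 1) := by gcongr
      _ ≤ _ := by gcongr
  have hκle : ∀ {r}, κ * D ^ (n ^ 2 + 1) ≤ r →
      min κ (c / (1 + 1 / s) ^ (n ^ 2 + 1)) * D ^ (n ^ 2 + 1) ≤ r := fun h =>
    (mul_le_mul_of_nonneg_right (min_le_left _ _) (by positivity)).trans h
  rcases ht with ht | ht
  · rw [hpe] at ht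
    exact hκle (hzero ht)
  · have hdt : evalEval x t (derivative F) = 0 := by
      rw [← ht, hp, ← map_evalRingHom_eval, derivative_map]
    rcases h2 x t hx hxδ.1 hdt with h0 | h0
    · exact hκle (hzero h0)
    · have hDx : D ≤ (1 + 1 / s) * x := by
        have : |y| ≤ x / s := by rwa [le_div_iff₀ hs, mul_comm]
        calc D ≤ x + |y| := hDz
          _ ≤ x + x / s := by gcongr
          _ = _ := by ring
      calc _ ≤ c / (1 + 1 / s) ^ (n ^ 2 + 1) * ((1 + 1 / s) * x) ^ (n ^ 2 + 1) := by
            gcongr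
            exact min_le_right _ _
        _ = c * x ^ (n ^ 2 + 1) := by
            rw [mul_pow]
            field_simp
        _ ≤ _ := h0.trans htp

lemma exists_gradient_bound_half_plane {E : Type*} [NormedAddCommGroup E] [NormedSpace ℝ E]
    {g : E → ℝ} (hg : Differentiable ℝ g) (hg0 : g 0 = 0) {a b : E} (ha : ‖a‖ = 1)
    (hb : ‖b‖ = 1) {F : ℝ[X][Y]} {n : ℕ}
    (hF : TotalDegLE F (n + 1 : ℕ)) {α : ℝ} (hα : α ≠ 0) (hFα : F.coeff (n + 1) = C α)
    (hgF : ∀ x y : ℝ, g (x • a + y • b) = evalEval x y F) {θ : ℝ} (hθ0 : 0 < θ)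
    (hθ : 1 - θ = 1 / (36 * (n + 1) ^ 3)) :
    ∃ c > 0, ∃ ε > 0, ∀ x y : ℝ, 0 ≤ x → x < ε → |y| < ε →
      c * ‖g (x • a + y • b)‖ ^ θ ≤ ‖fderiv ℝ g (x • a + y • b)‖ := by
  obtain ⟨c, hc, ε, hε, h⟩ := exists_gradient_bound_right hF hα hFα
    (by rw [← hgF]; simpa using hg0) hθ
  refine ⟨√(c / 2), by positivity, ε, hε, fun x y hx hxε hy => ?_⟩
  have hle : c * |evalEval x y F| ^ (2 * θ) ≤ evalEval x y (gradSq F) := by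
    rcases hx.eq_or_lt with rfl | hx
    · have hL : Continuous fun t => c * |evalEval t y F| ^ (2 * θ) := by
        refine continuous_const.mul (Continuous.rpow_const ?_ fun _ => .inr (by positivity))
        exact ((continuous_evalEval F).comp (continuous_id.prodMk continuous_const)).abs
      have hR : Continuous fun t => evalEval t y (gradSq F) :=
        (continuous_evalEval (gradSq F)).comp (continuous_id.prodMk continuous_const)
      refine le_of_tendsto_of_tendsto (hL.continuousAt.mono_left nhdsWithin_le_nhds)
        (hR.continuousAt.mono_left nhdsWithin_le_nhds) (b := 𝓝[>] (0 : ℝ)) ?_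
      filter_upwards [Ioo_mem_nhdsGT hε] with t ht using h t y ht.1 ht.2 hy
    · exact h x y hx hxε hy
  set z := x • a + y • b with hz
  have hX : evalEval x y (derivX F) = fderiv ℝ g z a := by
    have h1 := hasDerivAt_evalEval_comp F (hasDerivAt_id x) (hasDerivAt_const x y)
    have h2 : HasDerivAt (fun t : ℝ => t • a + y • b) a x := by
      simpa using ((hasDerivAt_id x).smul_const a).add_const (y • b)
    have h3 := (hg z).hasFDerivAt.comp_hasDerivAt x h2
    simpa using h1.unique (h3.congr_of_eventuallyEq (.of_forall fun t => (hgF t y).symm))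
  have hY : evalEval x y (derivative F) = fderiv ℝ g z b := by
    have h1 := hasDerivAt_evalEval_snd F x y
    have h2 : HasDerivAt (fun t : ℝ => x • a + t • b) b y := by
      simpa using ((hasDerivAt_id y).smul_const b).const_add (x • a)
    have h3 := (hg z).hasFDerivAt.comp_hasDerivAt y h2
    exact h1.unique (h3.congr_of_eventuallyEq (.of_forall fun t => (hgF x t).symm))
  rw [evalEval_gradSq, hX, hY, ← hgF, ← hz, mul_comm 2 θ, Real.rpow_mul (abs_nonneg _),
    ← Real.norm_eq_abs, Real.rpow_two] at hle
  have hsq : ∀ v : E, ‖v‖ = 1 → fderiv ℝ g z v ^ 2 ≤ ‖fderiv ℝ g z‖ ^ 2 := by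
    intro v hv
    rw [← sq_abs]
    gcongr
    simpa [hv] using (fderiv ℝ g z).le_opNorm v
  refine le_of_sq_le_sq ?_ (norm_nonneg _)
  rw [mul_pow, Real.sq_sqrt (by positivity)]
  linarith [hsq a ha, hsq b hb]

lemma differentiable_eval_euclidean {ι : Type*} [Fintype ι] (f : MvPolynomial ι ℝ) :
    Differentiable ℝ fun z : EuclideanSpace ℝ ι => MvPolynomial.eval (fun i => z i) f := by
  induction f using MvPolynomial.induction_on with
  | C c => simp
  | add p q hp hq =>
    simp only [map_add]
    exact hp.add hq
  | mul_X p i hp =>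
    simp only [map_mul, MvPolynomial.eval_X]
    exact hp.mul (by fun_prop)

/-- A rotated orthonormal frame in which a plane polynomial restricts well to lines. -/
lemma exists_good_frame {f : MvPolynomial (Fin 2) ℝ} {n : ℕ}
    (hdeg : f.totalDegree = n + 1) : ∃ a b : EuclideanSpace ℝ (Fin 2),
    ‖a‖ = 1 ∧ ‖b‖ = 1 ∧
    (∀ z, ∃ x y : ℝ, z = x • a + y • b ∧ |x| ≤ ‖z‖ ∧ |y| ≤ ‖z‖) ∧
    (∃ c > 0, ∃ s > 0, ∀ x y : ℝ, |x| < s * |y| → |y| < s →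
      c * |y| ^ (n ^ 2 + 1) ≤ |MvPolynomial.eval (fun i => (x • a + y • b) i) f|) ∧
    ∀ σ : ℝ, ∃ F : ℝ[X][Y], ∃ α : ℝ, TotalDegLE F (n + 1 : ℕ) ∧ α ≠ 0 ∧ F.coeff (n + 1) = C α ∧
      ∀ x y : ℝ, MvPolynomial.eval (fun i => (x • σ • a + y • b) i) f = evalEval x y F := by
  obtain ⟨k, hkd, hk, u, v, huv, hud, huk⟩ := exists_good_direction n.succ_pos hdeg
  have hu : |u| ≤ 1 := abs_le_one_iff_mul_self_le_one.2 (by nlinarith)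
  have hv : |v| ≤ 1 := abs_le_one_iff_mul_self_le_one.2 (by nlinarith)
  have hnorm : ∀ p q : ℝ, ‖(!₂[p, q] : EuclideanSpace ℝ (Fin 2))‖ = √(p ^ 2 + q ^ 2) := by
    intro p q
    simp [EuclideanSpace.norm_eq, Fin.sum_univ_two]
  have hcoord : ∀ (z : EuclideanSpace ℝ (Fin 2)) (p q : ℝ), p ^ 2 + q ^ 2 = 1 →
      |z 0 * p + z 1 * q| ≤ ‖z‖ := by
    intro z p q hpq
    rw [EuclideanSpace.norm_eq, Fin.sum_univ_two, Real.norm_eq_abs, Real.norm_eq_abs, sq_abs,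
      sq_abs]
    refine Real.abs_le_sqrt ?_
    nlinarith [sq_nonneg (z 0 * q - z 1 * p)]
  refine ⟨!₂[v, -u], !₂[u, v], ?_, ?_, fun z => ⟨z 0 * v + z 1 * -u, z 0 * u + z 1 * v, ?_,
    hcoord z _ _ (by linarith), hcoord z _ _ huv⟩, ?_, fun σ => ?_⟩
  · rw [hnorm, neg_sq, add_comm, huv, Real.sqrt_one]
  · rw [hnorm, huv, Real.sqrt_one]
  · ext i
    fin_cases i
    · simp
      linear_combination (-z 0) * huv
    · simp
      linear_combination (-z 1) * huv
  · obtain ⟨c, hc, ε, hε, h⟩ := exists_lower_bound_on_cone f hk huk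
    refine ⟨c, hc, min ε 1, by positivity, fun x y hxy hy => ?_⟩
    rw [lt_min_iff] at hy
    have hy0 : 0 < |y| := by
      refine (abs_nonneg y).lt_of_ne fun h0 => ?_
      rw [← h0, mul_zero] at hxy
      exact (abs_nonneg x).not_gt hxy
    have hyne : y ≠ 0 := abs_pos.1 hy0
    have hxε : |x / y| < ε := by
      rw [abs_div, div_lt_iff₀ hy0]
      exact hxy.trans_le (by gcongr; exact min_le_left _ _)
    have hw : ‖![x / y * v + u, x / y * -u + v] - ![u, v]‖ < ε := by
      have hle : ∀ p : ℝ, |p| ≤ 1 → |x / y * p| < ε := by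
        intro p hp
        rw [abs_mul]
        exact (mul_le_of_le_one_right (abs_nonneg _) hp).trans_lt hxε
      rw [pi_norm_lt_iff hε]
      intro i
      fin_cases i
      · simpa [abs_div] using hle v hv
      · simpa [abs_div] using hle u hu
    have e : (fun i => (x • !₂[v, -u] + y • !₂[u, v] : EuclideanSpace ℝ (Fin 2)) i) =
        y • ![x / y * v + u, x / y * -u + v] := by
      ext i
      fin_cases i
      · simp
        field_simp
      · simp
        field_simp
    rw [e]
    refine le_trans ?_ (h _ hw y hy.1)
    have hkN : k ≤ n ^ 2 + 1 := by
      rcases hkd.lt_or_eq with hlt | rfl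
      · nlinarith [Nat.le_self_pow two_ne_zero n]
      · nlinarith [Nat.le_self_pow two_ne_zero n]
    exact mul_le_mul_of_nonneg_left (pow_le_pow_of_le_one hy0.le hy.2.le hkN) hc.le
  · refine ⟨planeRestrict f (σ • ![v, -u]) ![u, v], _, ?_, hud,
      coeff_planeRestrict f _ _ hdeg, fun x y => ?_⟩
    · have := totalDegLE_planeRestrict f (σ • ![v, -u]) ![u, v]
      rwa [hdeg] at this
    · rw [evalEval_planeRestrict]
      congr 2

lemma exists_distance_bound {f : MvPolynomial (Fin 2) ℝ} {n : ℕ} (hdeg : f.totalDegree = n + 1)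
    (hf0 : MvPolynomial.constantCoeff f = 0) : ∃ c > 0, ∃ ε > 0,
    ∀ z : EuclideanSpace ℝ (Fin 2), ‖z‖ < ε →
      c * Metric.infDist z {w | MvPolynomial.eval (fun i => w i) f = 0} ^ (n ^ 2 + 1) ≤
        |MvPolynomial.eval (fun i => z i) f| := by
  obtain ⟨a, b, ha, hb, hz, ⟨c₀, hc₀, s, hs, hcone⟩, hF⟩ := exists_good_frame hdeg
  set g : EuclideanSpace ℝ (Fin 2) → ℝ := fun z => MvPolynomial.eval (fun i => z i) f with hg
  have hg0 : g 0 = 0 := by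
    rw [← hf0, ← MvPolynomial.eval_zero]
    rfl
  obtain ⟨F₁, α₁, hF₁, hα₁, hFα₁, hgF₁⟩ := hF 1
  obtain ⟨F₂, α₂, hF₂, hα₂, hFα₂, hgF₂⟩ := hF (-1)
  rw [one_smul] at hgF₁
  rw [neg_one_smul] at hgF₂
  obtain ⟨c₁, hc₁, ε₁, hε₁, h₁⟩ :=
    exists_distance_bound_off_cone hg0 ha hb hF₁ hα₁ hFα₁ hgF₁ hs
  obtain ⟨c₂, hc₂, ε₂, hε₂, h₂⟩ :=
    exists_distance_bound_off_cone hg0 (by rwa [norm_neg]) hb hF₂ hα₂ hFα₂ hgF₂ hs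
  set κ := min (min c₁ c₂) (c₀ / (1 + s) ^ (n ^ 2 + 1))
  refine ⟨κ, by positivity, min (min ε₁ ε₂) s, by positivity, fun z hzε => ?_⟩
  simp only [lt_min_iff] at hzε
  obtain ⟨x, y, rfl, hxz, hyz⟩ := hz z
  set D := Metric.infDist (x • a + y • b) {w | g w = 0}
  have hD0 : 0 ≤ D := Metric.infDist_nonneg
  have hκ : ∀ {c}, κ ≤ c → κ * D ^ (n ^ 2 + 1) ≤ c * D ^ (n ^ 2 + 1) := fun h => by gcongr
  rcases lt_or_ge |x| (s * |y|) with hxy | hxy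
  · refine le_trans ?_ (hcone x y hxy (by linarith))
    refine (hκ (min_le_right _ _)).trans ?_
    have hDy : D ≤ (1 + s) * |y| := by
      refine (Metric.infDist_le_dist_of_mem (show 0 ∈ {w | g w = 0} from hg0)).trans ?_
      rw [dist_zero_right]
      refine (norm_add_le _ _).trans ?_
      rw [norm_smul, norm_smul, ha, hb, Real.norm_eq_abs, Real.norm_eq_abs]
      linarith
    calc _ ≤ c₀ / (1 + s) ^ (n ^ 2 + 1) * ((1 + s) * |y|) ^ (n ^ 2 + 1) := by gcongr
      _ = _ := by
        rw [mul_pow]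
        field_simp
  · rcases lt_trichotomy x 0 with hx | rfl | hx
    · rw [abs_of_neg hx] at hxy hxz
      have := h₂ (-x) y (by linarith) (by linarith) hxy (by linarith)
      rw [← hgF₂, smul_neg, neg_smul, neg_neg] at this
      exact (hκ ((min_le_left _ _).trans (min_le_right _ _))).trans this
    · have hy : y = 0 := by
        rw [abs_zero] at hxy
        have := abs_nonneg y
        exact abs_eq_zero.1 (by nlinarith)
      have hD : D = 0 := by
        refine Metric.infDist_zero_of_mem ?_
        simpa [hy] using hg0
      rw [hD, zero_pow (by omega), mul_zero]
      positivity
    · rw [abs_of_pos hx] at hxy hxz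
      have := h₁ x y hx (by linarith) hxy (by linarith)
      rw [← hgF₁] at this
      exact (hκ ((min_le_left _ _).trans (min_le_left _ _))).trans this

lemma exists_gradient_bound {f : MvPolynomial (Fin 2) ℝ} {n : ℕ} (hdeg : f.totalDegree = n + 1)
    (hf0 : MvPolynomial.constantCoeff f = 0) : ∃ θ : ℝ, 0 < θ ∧ θ < 1 ∧ ∃ c > 0, ∃ ε > 0,
    ∀ z : EuclideanSpace ℝ (Fin 2), ‖z‖ < ε →
      c * ‖MvPolynomial.eval (fun i => z i) f‖ ^ θ ≤
        ‖fderiv ℝ (fun z : EuclideanSpace ℝ (Fin 2) => MvPolynomial.eval (fun i => z i) f) z‖ := by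
  obtain ⟨a, b, ha, hb, hz, -, hF⟩ := exists_good_frame hdeg
  have hgd := differentiable_eval_euclidean f
  set g : EuclideanSpace ℝ (Fin 2) → ℝ := fun z => MvPolynomial.eval (fun i => z i) f with hg
  have hg0 : g 0 = 0 := by
    rw [← hf0, ← MvPolynomial.eval_zero]
    rfl
  obtain ⟨F₁, α₁, hF₁, hα₁, hFα₁, hgF₁⟩ := hF 1
  obtain ⟨F₂, α₂, hF₂, hα₂, hFα₂, hgF₂⟩ := hF (-1)
  rw [one_smul] at hgF₁
  rw [neg_one_smul] at hgF₂
  set θ : ℝ := 1 - 1 / (36 * (n + 1) ^ 3) with hθ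
  have hn : (1 : ℝ) ≤ (n + 1) ^ 3 := one_le_pow₀ (by linarith [n.cast_nonneg (α := ℝ)])
  have hθ1 : θ < 1 := by
    rw [hθ, sub_lt_self_iff]
    positivity
  have hθ0 : 0 < θ := by
    rw [hθ, sub_pos, div_lt_one (by positivity)]
    linarith
  obtain ⟨c₁, hc₁, ε₁, hε₁, h₁⟩ :=
    exists_gradient_bound_half_plane hgd hg0 ha hb hF₁ hα₁ hFα₁ hgF₁ hθ0 (by rw [hθ]; ring)
  obtain ⟨c₂, hc₂, ε₂, hε₂, h₂⟩ := exists_gradient_bound_half_plane hgd hg0 (by rwa [norm_neg]) hb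
    hF₂ hα₂ hFα₂ hgF₂ hθ0 (by rw [hθ]; ring)
  refine ⟨θ, hθ0, hθ1, min c₁ c₂, by positivity, min ε₁ ε₂, by positivity, fun z hzε => ?_⟩
  rw [lt_min_iff] at hzε
  obtain ⟨x, y, rfl, hxz, hyz⟩ := hz z
  have hpos : 0 ≤ ‖g (x • a + y • b)‖ ^ θ := by positivity
  rcases le_total 0 x with hx | hx
  · rw [abs_of_nonneg hx] at hxz
    exact (mul_le_mul_of_nonneg_right (min_le_left _ _) hpos).trans
      (h₁ x y hx (by linarith) (by linarith))
  · rw [abs_of_nonpos hx] at hxz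
    have := h₂ (-x) y (by linarith) (by linarith) (by linarith)
    rw [smul_neg, neg_smul, neg_neg] at this
    exact (mul_le_mul_of_nonneg_right (min_le_right _ _) hpos).trans this

end

/-- for a real polynomial `f` of degree `d ≥ 1` on `ℝ²` with `f(0) = 0`,
`𝓛̃(f) ≤ 1/(1 - ℒ(f))` and consequently `𝓛̃(f) ≤ (d-1)² + 1`. -/
theorem stmt19 (d : ℕ) (hd : 1 ≤ d) (f : MvPolynomial (Fin 2) ℝ)
    (hdeg : f.totalDegree = d) (hf0 : MvPolynomial.constantCoeff f = 0) :
    LDE (fun z => MvPolynomial.eval (fun i => z i) f) ≤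
        1 / (1 - LGE (fun z : EuclideanSpace ℝ (Fin 2) =>
          MvPolynomial.eval (fun i => z i) f)) ∧
      LDE (fun z => MvPolynomial.eval (fun i => z i) f) ≤ ((d : ℝ) - 1) ^ 2 + 1 := by
  obtain ⟨n, rfl⟩ : ∃ n, d = n + 1 := ⟨d - 1, by omega⟩
  have hgd := differentiable_eval_euclidean f
  obtain ⟨θ, hθ0, hθ1, hθ⟩ := exists_gradient_bound hdeg hf0
  have hdist := exists_distance_bound hdeg hf0
  set g : EuclideanSpace ℝ (Fin 2) → ℝ := fun z => MvPolynomial.eval (fun i => z i) f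
  have hg0 : g 0 = 0 := by
    rw [← hf0, ← MvPolynomial.eval_zero]
    rfl
  have hle : ∀ {l : ℝ}, 0 < l → (∃ c > (0 : ℝ), ∃ ε > (0 : ℝ),
      ∀ z : EuclideanSpace ℝ (Fin 2), ‖z‖ < ε →
        c * (Metric.infDist z {w | g w = 0}) ^ l ≤ |g z|) → LDE g ≤ l :=
    fun hl h => csInf_le ⟨0, fun _ hl => hl.1.le⟩ ⟨hl, h⟩
  constructor
  · have hL0 : 0 ≤ LGE g := Real.sInf_nonneg fun _ hl => hl.1.le
    have hL1 : LGE g < 1 := lt_of_le_of_lt (csInf_le ⟨0, fun _ hl => hl.1.le⟩ ⟨hθ0, hθ⟩) hθ1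
    by_contra! hlt
    have hpos : 0 < LDE g := lt_trans (one_div_pos.2 (sub_pos.2 hL1)) hlt
    have hlt' : LGE g < 1 - 1 / LDE g := by
      have := (one_div_lt (sub_pos.2 hL1) hpos).1 hlt
      linarith
    obtain ⟨l, ⟨hl0, c, hc, ε, hε, h⟩, hl⟩ :=
      exists_lt_of_csInf_lt (by exact ⟨θ, hθ0, hθ⟩) hlt'
    have hl1 : 0 < 1 - l := by linarith [one_div_pos.2 hpos]
    have h1 := hle (one_div_pos.2 hl1) (exists_distance_bound_of_gradient_bound hgd hg0
      (sub_pos.1 hl1) hc hε h)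
    have h2 : 1 / (1 - l) < LDE g := (one_div_lt hl1 hpos).2 (by linarith)
    exact h1.not_gt h2
  · have e : (((n + 1 : ℕ) : ℝ) - 1) ^ 2 + 1 = ((n ^ 2 + 1 : ℕ) : ℝ) := by
      push_cast
      ring
    rw [e]
    refine hle (by positivity) ?_
    simpa only [Real.rpow_natCast] using hdist
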